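/- For any irreducible polynomial P(t) ∈ F_2[t], the quadratic irrational τ(P(t)) exhibits exactly 2/3 escape of mass with respect to the sequence {P(t)^k}_{k≥0}; and for any odd prime p and any irreducible polynomial P(t) ∈ F_p[t], the quadratic irrational Θ_p(P(t)) exhibits exactly 2/p escape of mass with respect to the sequence {P(t)^k}_{k≥0}. -/

import Mathlib

open scoped Classical
open Filter Polynomial

noncomputable section

namespace EscapeOfMass

variable {K : Type*} [Field K]

/-- The element `t` of `K((t⁻¹))`, modelled as the Laurent series field `K⸨X⸩`
in the variable `X = t⁻¹`; thus `t = X⁻¹ = single (-1) 1`. -/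
def tLS (K : Type*) [Field K] : LaurentSeries K := HahnSeries.single (-1 : ℤ) 1

/-- The polynomial part of a Laurent series in `K((t⁻¹))` (the terms with
non-negative powers of `t`, i.e. non-positive powers of `X`). -/
def polyPart (f : LaurentSeries K) : LaurentSeries K :=
  { coeff := fun n => if n ≤ 0 then f.coeff n else 0
    isPWO_support' := by
      refine f.isPWO_support'.mono fun n hn => ?_
      simp only [Function.mem_support, ne_eq] at hn ⊢
      intro h
      exact hn (by simp [h]) }

/-- The fractional part `⟨f⟩` of a Laurent series in `K((t⁻¹))`. -/
def fracPart (f : LaurentSeries K) : LaurentSeries K := f - polyPart f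

/-- The complete quotients of the continued fraction expansion of `f`. -/
def cfQuot (f : LaurentSeries K) : ℕ → LaurentSeries K
  | 0 => f
  | i + 1 => (cfQuot f i - polyPart (cfQuot f i))⁻¹

/-- The partial quotients `A_i` of the continued fraction expansion of `f`. -/
def cfPQ (f : LaurentSeries K) (i : ℕ) : LaurentSeries K := polyPart (cfQuot f i)

/-- The degree (as an integer) of a Laurent series viewed in `K((t⁻¹))`:
for a nonzero polynomial in `t` this is the usual degree. -/
def degZ (f : LaurentSeries K) : ℤ := -f.order

/-- `f` is a rational Laurent series, i.e. lies in `K(t)`. -/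
def IsRatLS (f : LaurentSeries K) : Prop := ∃ r : RatFunc K, (r : LaurentSeries K) = f

/-- `f` is a quadratic irrational: it is irrational and a root of a quadratic
polynomial with coefficients in `K[t]`. -/
def IsQuadIrr (f : LaurentSeries K) : Prop :=
  ¬ IsRatLS f ∧ ∃ a b c : Polynomial K, a ≠ 0 ∧
    Polynomial.aeval (tLS K) a * f ^ 2 + Polynomial.aeval (tLS K) b * f +
      Polynomial.aeval (tLS K) c = 0

/-- `(m, ℓ)` is a window for the periodic part of the continued fraction of `f`:
the partial quotients are periodic with period `ℓ ≥ 1` from index `m + 1` on. -/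
def PeriodWindow (f : LaurentSeries K) (m ℓ : ℕ) : Prop :=
  1 ≤ ℓ ∧ ∀ i : ℕ, m + 1 ≤ i → cfPQ f (i + ℓ) = cfPQ f i

/-- The `n`-escape of mass of the continued fraction expansion of `f`: the proportion,
within one period of the periodic part of the partial quotients of `f`, of the sum
`∑ max (deg A_i - n) 0` relative to `∑ deg A_i`. -/
def eMassOf (f : LaurentSeries K) (n : ℕ) : ℝ :=
  if h : ∃ s : ℕ × ℕ, PeriodWindow f s.1 s.2 then
    (∑ i ∈ Finset.Ico ((Classical.choose h).1 + 1)
        ((Classical.choose h).1 + 1 + (Classical.choose h).2),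
        max ((degZ (cfPQ f i) : ℝ) - n) 0) /
    (∑ i ∈ Finset.Ico ((Classical.choose h).1 + 1)
        ((Classical.choose h).1 + 1 + (Classical.choose h).2),
        (degZ (cfPQ f i) : ℝ))
  else 0

/-- The `n`-escape of mass in the `k`-th diagonal of `f` with respect to the
sequence `{g^k}`. -/
def eMassP (g f : LaurentSeries K) (k n : ℕ) : ℝ := eMassOf (g ^ k * f) n

/-- The `n`-escape of mass in the `k`-th diagonal of `f` with respect to `{t^k}`. -/
def eMass (f : LaurentSeries K) (k n : ℕ) : ℝ := eMassP (tLS K) f k n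

/-- `f` exhibits `c` escape of mass with respect to the sequence `{g^k}`. -/
def ExhibitsEscape (g f : LaurentSeries K) (c : ℝ) : Prop :=
  ∃ L : ℝ, Tendsto (fun n : ℕ => Filter.liminf (fun k : ℕ => eMassP g f k n) atTop)
    atTop (nhds L) ∧ c ≤ L

/-- `f` exhibits exactly `c` escape of mass with respect to the sequence `{g^k}`. -/
def ExhibitsExactEscape (g f : LaurentSeries K) (c : ℝ) : Prop :=
  Tendsto (fun n : ℕ => Filter.liminf (fun k : ℕ => eMassP g f k n) atTop)
    atTop (nhds c)

/-- `f` exhibits full (`c = 1`) maximal escape of mass with respect to `{g^k}`. -/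
def ExhibitsFullMaxEscape (g f : LaurentSeries K) : Prop :=
  Tendsto (fun n : ℕ => Filter.limsup (fun k : ℕ => eMassP g f k n) atTop)
    atTop (nhds 1)

/-- `A ⊆ ℕ` has natural density `c`. -/
def HasDensity (A : Set ℕ) (c : ℝ) : Prop :=
  Tendsto (fun M : ℕ => (((Finset.Icc 1 M).filter fun k => k ∈ A).card : ℝ) / M)
    atTop (nhds c)

/-- `f` exhibits full generic escape of mass with respect to `{t^k}`. -/
def FullGenericEscape (f : LaurentSeries K) : Prop :=
  ∀ ε : ℝ, 0 < ε → ∃ dens : ℕ → ℝ,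
    (∀ n : ℕ, HasDensity {k : ℕ | 1 - ε < eMass f k n} (dens n)) ∧
    Tendsto dens atTop (nhds 1)

/-- Substitution `t ↦ P(t)` on Laurent series: for `f = ∑_{i ≥ d} a_i t^{-i}` (with
`d = f.order` in the variable `X = t⁻¹`), `substLS f P = ∑_{i ≥ d} a_i P(t)^{-i}`. -/
def substLS (f : LaurentSeries K) (P : Polynomial K) : LaurentSeries K :=
  (Polynomial.aeval (tLS K) P)⁻¹ ^ f.order *
    HahnSeries.ofPowerSeries ℤ K
      (PowerSeries.mk fun n =>
        ∑ j ∈ Finset.range (n + 1),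
          f.coeff (f.order + j) * (((Polynomial.aeval (tLS K) P)⁻¹ ^ j).coeff (n : ℤ)))

/-- The `p`-Cantor sequence over `ZMod p`. -/
def cantor (p : ℕ) : ℕ → ZMod p
  | 0 => 1
  | (n + 1) =>
    if hp : 1 < p then
      if (n + 1) % p % 2 = 1 then 0
      else (((p - 1) / 2).choose (((n + 1) % p) / 2) : ZMod p) * cantor p ((n + 1) / p)
    else 0
  decreasing_by exact Nat.div_lt_self (Nat.succ_pos _) hp

/-- `Θ̃_p = ∑_{i ≥ 0} c_i^{(p)} t^{-i}`. -/
def cantorTilde (p : ℕ) : LaurentSeries (ZMod p) :=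
  HahnSeries.ofPowerSeries ℤ (ZMod p) (PowerSeries.mk fun i => cantor p i)

/-- `Θ_p = t⁻¹ ∑_{i ≥ 0} c_i^{(p)} t^{-i}`. -/
def cantorTheta (p : ℕ) : LaurentSeries (ZMod p) :=
  HahnSeries.single (1 : ℤ) 1 * cantorTilde p

/-- The Thue–Morse sequence over `ZMod 2`. -/
def thueMorse (n : ℕ) : ZMod 2 := ((Nat.digits 2 n).sum : ZMod 2)

/-- The Thue–Morse Laurent series `τ = ∑_{n ≥ 1} τ_n t^{-n}`. -/
def tmSeries : LaurentSeries (ZMod 2) :=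
  HahnSeries.ofPowerSeries ℤ (ZMod 2) (PowerSeries.mk fun n => thueMorse n)

/-- The extension of a one-sided sequence to `ℤ` by zero. -/
def extendSeq (S : ℕ → K) : ℤ → K := fun i => if 0 ≤ i then S i.toNat else 0

/-- The entry `W(S)[m, n]` of the number wall of the (doubly infinite) sequence `s`:
the determinant of the `(m+1) × (m+1)` Toeplitz matrix `(s_{n - i + j})`. -/
def wallEntry (s : ℤ → K) (m : ℕ) (n : ℤ) : K :=
  (Matrix.of fun i j : Fin (m + 1) => s (n - (i : ℕ) + (j : ℕ))).det

/-- The Laurent series `t⁻¹ ∑_{i ≥ 0} s_i t^{-i}` associated to a sequence. -/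
def seriesOf (S : ℕ → K) : LaurentSeries K :=
  HahnSeries.single (1 : ℤ) 1 * HahnSeries.ofPowerSeries ℤ K (PowerSeries.mk S)

/-- The coefficient sequence of `Θ = t⁻¹ ∑ s_i t^{-i}`, extended to `ℤ` by zero. -/
def coeffSeq (f : LaurentSeries K) : ℤ → K := fun i => if 0 ≤ i then f.coeff (i + 1) else 0

/-- The absolute value of a Laurent series in `F_q((t⁻¹))`: `|f| = q^{deg f}`. -/
def absLS {K : Type*} [Field K] [Fintype K] (f : LaurentSeries K) : ℝ :=
  if f = 0 then 0 else (Fintype.card K : ℝ) ^ (-f.order)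


/-- order at least `c` -/
def oge (c : ℤ) (g : LaurentSeries K) : Prop := (c : WithTop ℤ) ≤ g.orderTop

lemma oge_zero (c : ℤ) : oge c (0 : LaurentSeries K) := by simp [oge]

lemma oge_iff {c : ℤ} {g : LaurentSeries K} (hg : g ≠ 0) : oge c g ↔ c ≤ g.order := by
  unfold oge
  rw [← HahnSeries.order_eq_orderTop_of_ne_zero hg]
  exact WithTop.coe_le_coe

lemma oge.le {c : ℤ} {g : LaurentSeries K} (h : oge c g) (hg : g ≠ 0) : c ≤ g.order :=
  (oge_iff hg).1 h

lemma oge_order (g : LaurentSeries K) : oge g.order g := by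
  by_cases hg : g = 0
  · subst hg; exact oge_zero _
  · exact (oge_iff hg).2 le_rfl

lemma oge.mono {c d : ℤ} {g : LaurentSeries K} (h : oge c g) (hd : d ≤ c) : oge d g :=
  le_trans (WithTop.coe_le_coe.2 hd) h

lemma oge.add {c : ℤ} {f g : LaurentSeries K} (hf : oge c f) (hg : oge c g) : oge c (f + g) :=
  le_trans (le_min hf hg) HahnSeries.min_orderTop_le_orderTop_add

lemma oge.neg {c : ℤ} {f : LaurentSeries K} (hf : oge c f) : oge c (-f) := by
  unfold oge at *; rwa [HahnSeries.orderTop_neg]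

lemma oge.sub {c : ℤ} {f g : LaurentSeries K} (hf : oge c f) (hg : oge c g) : oge c (f - g) := by
  rw [sub_eq_add_neg]; exact hf.add hg.neg

lemma oge.mul {c d : ℤ} {f g : LaurentSeries K} (hf : oge c f) (hg : oge d g) :
    oge (c + d) (f * g) := by
  unfold oge at *
  rw [HahnSeries.orderTop_mul]
  push_cast
  exact add_le_add hf hg

lemma oge.pow {c : ℤ} {f : LaurentSeries K} (hf : oge c f) (n : ℕ) :
    oge (n * c) (f ^ n) := by
  induction n with
  | zero => simp [oge]
  | succ n ih =>
    rw [pow_succ]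
    exact (ih.mul hf).mono (by push_cast; linarith)

lemma oge_coeff {c : ℤ} {g : LaurentSeries K} (h : ∀ m < c, g.coeff m = 0) : oge c g := by
  by_cases hg : g = 0
  · subst hg; exact oge_zero _
  · rw [oge_iff hg]
    by_contra hlt
    push Not at hlt
    have := h _ hlt
    exact HahnSeries.coeff_order_eq_zero.not.2 hg this

lemma oge.coeff {c : ℤ} {g : LaurentSeries K} (h : oge c g) {m : ℤ} (hm : m < c) :
    g.coeff m = 0 := by
  apply HahnSeries.coeff_eq_zero_of_lt_orderTop
  exact lt_of_lt_of_le (WithTop.coe_lt_coe.2 hm) h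

lemma order_add_left {f g : LaurentSeries K} (hf : f ≠ 0) (hg : oge (f.order + 1) g) :
    f + g ≠ 0 ∧ (f + g).order = f.order := by
  have h1 : f.orderTop < g.orderTop := by
    rw [← HahnSeries.order_eq_orderTop_of_ne_zero hf]
    exact lt_of_lt_of_le (WithTop.coe_lt_coe.2 (by omega)) hg
  have h2 := HahnSeries.orderTop_add_eq_left h1
  have h3 : f + g ≠ 0 := by
    intro h
    rw [h, HahnSeries.orderTop_zero] at h2
    rw [← h2] at h1
    exact absurd h1 (by simp)
  refine ⟨h3, ?_⟩
  have := HahnSeries.order_eq_orderTop_of_ne_zero h3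
  rw [h2, ← HahnSeries.order_eq_orderTop_of_ne_zero hf] at this
  exact_mod_cast this

lemma algC (a : K) : algebraMap K (LaurentSeries K) a = HahnSeries.C a := by
  rw [HahnSeries.algebraMap_apply', ← HahnSeries.ofPowerSeries_C]; rfl

lemma oge_aeval_C (a : K) : oge 0 (algebraMap K (LaurentSeries K) a) := by
  rw [algC]
  apply oge_coeff
  intro m hm
  rw [HahnSeries.C_apply]
  exact HahnSeries.coeff_single_of_ne (by omega)

lemma algebraMap_order (a : K) : (algebraMap K (LaurentSeries K) a).order = 0 := by
  rw [algC]
  exact HahnSeries.order_C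

lemma algebraMap_ne {a : K} (ha : a ≠ 0) : algebraMap K (LaurentSeries K) a ≠ 0 := by
  simpa using ha

lemma order_inv' {f : LaurentSeries K} (hf : f ≠ 0) : (f⁻¹).order = - f.order := by
  have := HahnSeries.order_mul hf (inv_ne_zero hf)
  rw [mul_inv_cancel₀ hf, HahnSeries.order_one] at this
  omega

lemma order_div' {f g : LaurentSeries K} (hf : f ≠ 0) (hg : g ≠ 0) :
    (f / g).order = f.order - g.order := by
  rw [div_eq_mul_inv, HahnSeries.order_mul hf (inv_ne_zero hg), order_inv' hg]; ring

/-- Order of a polynomial evaluated at a large element. -/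
lemma order_aeval {w : LaurentSeries K} (hw : w.order < 0) (Q : K[X]) (hQ : Q ≠ 0) :
    aeval w Q ≠ 0 ∧ (aeval w Q).order = Q.natDegree * w.order := by
  have hw0 : w ≠ 0 := by rintro rfl; simp at hw
  induction Q using Polynomial.recOnHorner with
  | M0 => exact absurd rfl hQ
  | MC p a hp ha ih =>
    by_cases hp0 : p = 0
    · subst hp0
      simp only [zero_add, aeval_C, natDegree_C, Nat.cast_zero, zero_mul]
      exact ⟨algebraMap_ne ha, algebraMap_order a⟩
    · obtain ⟨h1, h2⟩ := ih hp0
      have hd : 1 ≤ p.natDegree := by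
        by_contra h
        have : p.natDegree = 0 := by omega
        rw [Polynomial.eq_C_of_natDegree_eq_zero this, hp] at hp0
        simp at hp0
      have h3 : oge ((aeval w p).order + 1) (algebraMap K (LaurentSeries K) a) := by
        refine (oge_aeval_C a).mono ?_
        rw [h2]
        have : (1:ℤ) ≤ p.natDegree := by exact_mod_cast hd
        nlinarith
      rw [map_add, aeval_C, natDegree_add_C, ← h2]
      exact order_add_left h1 h3
  | MX p hp ih =>
    obtain ⟨h1, h2⟩ := ih hp
    rw [map_mul, aeval_X, natDegree_mul_X hp]
    refine ⟨mul_ne_zero h1 hw0, ?_⟩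
    rw [HahnSeries.order_mul h1 hw0, h2]
    push_cast; ring

/-- low order of a polynomial evaluated at a small element. -/
lemma X_pow_dvd_of_order {w : LaurentSeries K} (hw : w.order = 1) :
    ∀ (N : ℕ) (H : K[X]), oge N (aeval w H) → (X ^ N : K[X]) ∣ H := by
  have hw0 : w ≠ 0 := by rintro rfl; simp at hw
  intro N
  induction N with
  | zero => intro H _; simp
  | succ N ih =>
    intro H hH
    have hs : aeval w H = aeval w (divX H) * w + algebraMap K _ (H.coeff 0) := by
      conv_lhs => rw [← divX_mul_X_add H]
      simp
    have hge0 : ∀ Q : K[X], oge 0 (aeval w Q) := by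
      intro Q
      induction Q using Polynomial.induction_on' with
      | add p q hp hq => rw [map_add]; exact hp.add hq
      | monomial n a =>
        rw [aeval_monomial]
        have := (oge_aeval_C a).mul ((oge_order w).pow n)
        rw [hw] at this
        exact this.mono (by omega)
    have hc : H.coeff 0 = 0 := by
      by_contra hne
      have h1 : oge (1 : ℤ) (algebraMap K (LaurentSeries K) (H.coeff 0)) := by
        have : algebraMap K (LaurentSeries K) (H.coeff 0) = aeval w H - aeval w (divX H) * w := by
          rw [hs]; ring
        rw [this]
        refine (hH.mono (by push_cast; omega)).sub ?_
        have := (hge0 (divX H)).mul (oge_order w)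
        rw [hw] at this
        simpa using this
      have := h1.le (algebraMap_ne hne)
      rw [algebraMap_order] at this
      omega
    have h2 : oge N (aeval w (divX H)) := by
      rw [hc, map_zero, add_zero] at hs
      have : aeval w (divX H) = aeval w H * w⁻¹ := by rw [hs]; field_simp
      rw [this]
      have h3 := hH.mul (oge_order w⁻¹)
      rw [order_inv' hw0, hw] at h3
      exact h3.mono (by push_cast; omega)
    have := ih _ h2
    rw [← divX_mul_X_add H, hc, C_0, add_zero, pow_succ]
    exact mul_dvd_mul_right this X

lemma tLS_order : (tLS K).order = -1 := HahnSeries.order_single one_ne_zero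

lemma tLS_ne : tLS K ≠ 0 := by
  intro h; have := tLS_order (K := K); rw [h] at this; simp at this

/-- polynomial as Laurent series in `t⁻¹` -/
abbrev pt (Q : K[X]) : LaurentSeries K := aeval (tLS K) Q

lemma pt_ne {Q : K[X]} (hQ : Q ≠ 0) : pt Q ≠ 0 :=
  (order_aeval (by rw [tLS_order]; norm_num) Q hQ).1

lemma pt_order {Q : K[X]} (hQ : Q ≠ 0) : (pt Q).order = -(Q.natDegree : ℤ) := by
  rw [(order_aeval (by rw [tLS_order]; norm_num) Q hQ).2, tLS_order]; ring

lemma pt_oge (Q : K[X]) : oge (-(Q.natDegree : ℤ)) (pt Q) := by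
  by_cases hQ : Q = 0
  · subst hQ; simp only [pt, map_zero]; exact oge_zero _
  · rw [← pt_order hQ]; exact oge_order _

lemma pt_inj {Q P : K[X]} (h : pt Q = pt P) : Q = P := by
  by_contra hne
  exact pt_ne (sub_ne_zero.2 hne) (by simp only [pt, map_sub]; exact sub_eq_zero.2 h)

lemma pt_zero_of_oge {Q : K[X]} (h : oge 1 (pt Q)) : Q = 0 := by
  by_contra hQ
  have := h.le (pt_ne hQ)
  rw [pt_order hQ] at this
  omega

lemma natDegree_le_of_oge {Q : K[X]} {c : ℕ} (h : oge (-(c : ℤ)) (pt Q)) : Q.natDegree ≤ c := by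
  by_cases hQ : Q = 0
  · subst hQ; simp
  · have := h.le (pt_ne hQ)
    rw [pt_order hQ] at this
    omega

lemma polyPart_oge (f : LaurentSeries K) : oge 1 (f - polyPart f) := by
  apply oge_coeff
  intro m hm
  rw [HahnSeries.coeff_sub]
  have : (polyPart f).coeff m = if m ≤ 0 then f.coeff m else 0 := rfl
  rw [this, if_pos (by omega), sub_self]

lemma pt_coeff (Q : K[X]) (m : ℤ) :
    (pt Q).coeff m = if m ≤ 0 then Q.coeff (-m).toNat else 0 := by
  induction Q using Polynomial.induction_on' with
  | add p q hp hq =>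
    simp only [pt, map_add, HahnSeries.coeff_add, coeff_add] at *
    rw [hp, hq]; split_ifs <;> simp
  | monomial n a =>
    simp only [pt, aeval_monomial, tLS]
    rw [algC, HahnSeries.single_pow, HahnSeries.C_apply,
      HahnSeries.single_mul_single, one_pow, mul_one, HahnSeries.coeff_single, coeff_monomial]
    simp only [nsmul_eq_mul, mul_neg, mul_one, zero_add]
    split_ifs <;> first | rfl | omega

lemma polyPart_exists (f : LaurentSeries K) : ∃ A : K[X], polyPart f = pt A := by
  let N := (-f.order).toNat + 1
  refine ⟨∑ i ∈ Finset.range N, monomial i (f.coeff (-(i : ℤ))), ?_⟩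
  ext m
  rw [pt_coeff]
  have : (polyPart f).coeff m = if m ≤ 0 then f.coeff m else 0 := rfl
  rw [this]
  split_ifs with h
  · rw [finsetSum_coeff]
    simp only [coeff_monomial]
    rw [Finset.sum_ite_eq']
    split_ifs with h2
    · congr 1; omega
    · by_contra hne
      have := HahnSeries.order_le_of_coeff_ne_zero hne
      apply h2
      simp only [Finset.mem_range, N]
      omega
  · rfl

lemma polyPart_eq {f : LaurentSeries K} {A : K[X]} (h : oge 1 (f - pt A)) :
    polyPart f = pt A := by
  obtain ⟨B, hB⟩ := polyPart_exists f
  have h2 := polyPart_oge f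
  rw [hB] at h2 ⊢
  have : pt (B - A) = (f - pt A) - (f - pt B) := by simp only [pt, map_sub]; ring
  have h3 : oge 1 (pt (B - A)) := by rw [this]; exact h.sub h2
  have := pt_zero_of_oge h3
  rw [sub_eq_zero.1 this]

/-- irrationality in elementary form -/
def Irr (f : LaurentSeries K) : Prop := ∀ Q P : K[X], Q ≠ 0 → pt Q * f ≠ pt P

lemma not_isRat_of_irr {f : LaurentSeries K} (h : Irr f) : ¬ IsRatLS f := by
  rintro ⟨r, hr⟩
  have ht : (HahnSeries.single (1 : ℤ) (1 : K)) = (tLS K)⁻¹ := by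
    rw [tLS, HahnSeries.inv_single]; simp
  obtain ⟨ψ, hψ⟩ : ∃ ψ : RatFunc K →+* LaurentSeries K,
    ∀ r, ψ r = ((r : RatFunc K) : LaurentSeries K) := ⟨_, fun _ => rfl⟩
  have hX : ψ (algebraMap K[X] (RatFunc K) X) = (tLS K)⁻¹ := by
    rw [RatFunc.algebraMap_X, hψ, RatFunc.coe_X, ht]
  have hev : ∀ p : K[X], ψ (algebraMap K[X] (RatFunc K) p)
      = eval₂ (algebraMap K (LaurentSeries K)) (tLS K)⁻¹ p := by
    intro p
    induction p using Polynomial.induction_on' with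
    | add p q hp hq => rw [map_add, map_add, eval₂_add, hp, hq]
    | monomial n a =>
      rw [← C_mul_X_pow_eq_monomial, map_mul, map_mul, map_pow, map_pow, hX, eval₂_mul, eval₂_C,
        eval₂_pow, eval₂_X]
      congr 1
      have := RatFunc.coe_coe (C a)
      rw [Polynomial.coe_C, HahnSeries.ofPowerSeries_C] at this
      rw [algC, this]
      exact hψ _
  let _ : Invertible (tLS K)⁻¹ := invertibleOfNonzero (inv_ne_zero tLS_ne)
  have hinv : ⅟((tLS K)⁻¹) = tLS K := by rw [invOf_eq_inv, inv_inv]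
  have hrev : ∀ p : K[X],
      ψ (algebraMap K[X] (RatFunc K) p) = pt p.reverse * ((tLS K)⁻¹) ^ p.natDegree := by
    intro p
    have := eval₂_reverse_mul_pow (algebraMap K (LaurentSeries K)) (tLS K)⁻¹ p
    rw [hev, ← this, hinv]
    rfl
  have hden : r.denom ≠ 0 := RatFunc.denom_ne_zero r
  have h1 : ψ r * ψ (algebraMap K[X] (RatFunc K) r.denom)
      = ψ (algebraMap K[X] (RatFunc K) r.num) := by
    rw [← map_mul]
    congr 1
    have := RatFunc.num_div_denom r
    rw [eq_comm, eq_div_iff] at this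
    · exact this
    · exact RatFunc.algebraMap_ne_zero hden
  rw [hrev, hrev, hψ, hr] at h1
  have htn := tLS_ne (K := K)
  refine h (r.denom.reverse * X ^ r.num.natDegree) (r.num.reverse * X ^ r.denom.natDegree)
    (mul_ne_zero (by simpa using hden) (pow_ne_zero _ X_ne_zero)) ?_
  simp only [pt, map_mul, map_pow, aeval_X] at h1 ⊢
  rw [inv_pow, inv_pow] at h1
  field_simp at h1
  linear_combination h1


lemma Irr.ne {f : LaurentSeries K} (h : Irr f) : f ≠ 0 := by
  rintro rfl
  exact h 1 0 one_ne_zero (by simp)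

lemma Irr.sub_pt {f : LaurentSeries K} (h : Irr f) (A : K[X]) : Irr (f - pt A) := by
  intro Q P hQ he
  refine h Q (P + Q * A) hQ ?_
  simp only [pt, map_add, map_mul] at he ⊢
  linear_combination he

lemma Irr.inv {f : LaurentSeries K} (h : Irr f) : Irr f⁻¹ := by
  intro Q P hQ he
  have hf := h.ne
  by_cases hP : P = 0
  · subst hP
    rw [show pt (0 : K[X]) = 0 by simp] at he
    exact mul_ne_zero (pt_ne hQ) (inv_ne_zero hf) he
  · refine h P Q hP ?_
    rw [← he]; field_simp

lemma Irr.mul_t {f : LaurentSeries K} (h : Irr f) (k : ℕ) : Irr (tLS K ^ k * f) := by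
  intro Q P hQ he
  refine h (Q * X ^ k) P (mul_ne_zero hQ (pow_ne_zero _ X_ne_zero)) ?_
  simp only [pt, map_mul, map_pow, aeval_X] at he ⊢
  linear_combination he

/-- partial quotients as polynomials -/
def cfA (f : LaurentSeries K) (i : ℕ) : K[X] := (polyPart_exists (cfQuot f i)).choose

lemma cfA_spec (f : LaurentSeries K) (i : ℕ) : cfPQ f i = pt (cfA f i) :=
  (polyPart_exists (cfQuot f i)).choose_spec

lemma cfQuot_succ (f : LaurentSeries K) (i : ℕ) :
    cfQuot f (i + 1) = (cfQuot f i - pt (cfA f i))⁻¹ := by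
  rw [← cfA_spec]; rfl

lemma cfQuot_irr {f : LaurentSeries K} (h : Irr f) (i : ℕ) : Irr (cfQuot f i) := by
  induction i with
  | zero => exact h
  | succ i ih => rw [cfQuot_succ]; exact (ih.sub_pt _).inv

lemma cfQuot_order_neg {f : LaurentSeries K} (h : Irr f) (i : ℕ) :
    (cfQuot f (i + 1)).order < 0 := by
  rw [cfQuot_succ, order_inv' ((cfQuot_irr h i).sub_pt _).ne]
  have h1 := polyPart_oge (cfQuot f i)
  rw [show polyPart (cfQuot f i) = pt (cfA f i) from cfA_spec f i] at h1
  have := h1.le ((cfQuot_irr h i).sub_pt _).ne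
  omega

/-- degrees of partial quotients -/
def cfa (f : LaurentSeries K) (i : ℕ) : ℕ := (cfA f i).natDegree

lemma cfA_order {f : LaurentSeries K} (h : Irr f) (i : ℕ) :
    cfA f (i + 1) ≠ 0 ∧ (cfQuot f (i + 1)).order = -(cfa f (i + 1) : ℤ) := by
  have h1 := polyPart_oge (cfQuot f (i+1))
  rw [show polyPart (cfQuot f (i+1)) = pt (cfA f (i+1)) from cfA_spec f (i+1)] at h1
  have h2 := cfQuot_order_neg h i
  have h3 : pt (cfA f (i+1)) = cfQuot f (i+1) + -(cfQuot f (i+1) - pt (cfA f (i+1))) := by ring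
  have h4 := order_add_left (cfQuot_irr h (i+1)).ne (h1.neg.mono (d := (cfQuot f (i+1)).order + 1)
    (by omega))
  rw [← h3] at h4
  have h5 : cfA f (i+1) ≠ 0 := by
    intro h0; rw [h0] at h4; simp at h4
  refine ⟨h5, ?_⟩
  rw [← h4.2, pt_order h5]; rfl

lemma cfa_pos {f : LaurentSeries K} (h : Irr f) (i : ℕ) : 1 ≤ cfa f (i + 1) := by
  have h1 := (cfA_order h i).2
  have h2 := cfQuot_order_neg h i
  omega

lemma degZ_cfPQ {f : LaurentSeries K} (h : Irr f) (i : ℕ) :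
    degZ (cfPQ f (i + 1)) = cfa f (i + 1) := by
  rw [degZ, cfA_spec, pt_order (cfA_order h i).1]; simp [cfa]

/-- denominators of convergents (shifted by one) -/
def cQ (f : LaurentSeries K) : ℕ → K[X]
  | 0 => 0
  | 1 => 1
  | (i + 2) => cfA f (i + 1) * cQ f (i + 1) + cQ f i

/-- numerators of convergents (shifted by one) -/
def cP (f : LaurentSeries K) : ℕ → K[X]
  | 0 => 1
  | 1 => cfA f 0
  | (i + 2) => cfA f (i + 1) * cP f (i + 1) + cP f i

/-- approximation errors -/
def cE (f : LaurentSeries K) (i : ℕ) : LaurentSeries K := pt (cQ f i) * f - pt (cP f i)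

/-- sum of degrees -/
def cD (f : LaurentSeries K) (i : ℕ) : ℕ := ∑ j ∈ Finset.range i, cfa f (j + 1)

lemma cD_succ (f : LaurentSeries K) (i : ℕ) : cD f (i+1) = cD f i + cfa f (i+1) := by
  rw [cD, Finset.sum_range_succ]; rfl

lemma cE_step (f : LaurentSeries K) (i : ℕ) :
    cE f (i+2) = pt (cfA f (i+1)) * cE f (i+1) + cE f i := by
  simp only [cE, cQ, cP, pt, map_add, map_mul]; ring

lemma cE_rel {f : LaurentSeries K} (h : Irr f) (i : ℕ) :
    cE f i = - cfQuot f (i+1) * cE f (i+1) := by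
  induction i with
  | zero =>
    have h0 : cE f 1 = (cfQuot f 1)⁻¹ := by
      rw [cfQuot_succ, inv_inv]; simp [cE, cQ, cP, cfQuot]
    have h1 := (cfQuot_irr h 1).ne
    rw [h0]
    simp only [zero_add]
    rw [neg_mul, mul_inv_cancel₀ h1]
    simp [cE, cQ, cP]
  | succ i ih =>
    rw [cE_step, ih, cfQuot_succ f (i+1)]
    have h1 := ((cfQuot_irr h (i+1)).sub_pt (cfA f (i+1))).ne
    field_simp
    ring

lemma cdet (f : LaurentSeries K) (i : ℕ) :
    cQ f (i+1) * cP f i - cP f (i+1) * cQ f i = (-1) ^ i := by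
  induction i with
  | zero => simp [cQ, cP]
  | succ i ih =>
    simp only [cQ, cP]
    rw [pow_succ, ← ih]; ring

lemma cE_order {f : LaurentSeries K} (h : Irr f) (i : ℕ) :
    cE f i ≠ 0 ∧ (cE f i).order = cD f i := by
  induction i with
  | zero =>
    have : cE f 0 = -1 := by simp [cE, cQ, cP]
    rw [this]
    refine ⟨by simp, ?_⟩
    rw [HahnSeries.order_neg, HahnSeries.order_one]; simp [cD]
  | succ i ih =>
    have h1 := cE_rel h i
    have h0 : cE f (i+1) ≠ 0 := by
      intro h0; rw [h0, mul_zero] at h1; exact ih.1 h1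
    refine ⟨h0, ?_⟩
    have h2 := congrArg HahnSeries.order h1
    rw [HahnSeries.order_mul (neg_ne_zero.2 (cfQuot_irr h (i+1)).ne) h0, HahnSeries.order_neg,
      (cfA_order h i).2, ih.2] at h2
    rw [cD_succ]; push_cast; omega

lemma cQ_deg {f : LaurentSeries K} (h : Irr f) (i : ℕ) :
    cQ f (i+1) ≠ 0 ∧ (cQ f (i+1)).natDegree = cD f i ∧ (cQ f i).degree < (cQ f (i+1)).degree := by
  induction i with
  | zero => simp [cQ, cD]
  | succ i ih =>
    obtain ⟨h1, h2, h3⟩ := ih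
    have hA := (cfA_order h i).1
    have hpos := cfa_pos h i
    have hm : (cfA f (i+1) * cQ f (i+1)) ≠ 0 := mul_ne_zero hA h1
    have hd : (cQ f (i+1)).degree < (cfA f (i+1) * cQ f (i+1)).degree := by
      rw [degree_eq_natDegree h1, degree_eq_natDegree hm, natDegree_mul hA h1]
      have : cfa f (i+1) = (cfA f (i+1)).natDegree := rfl
      exact_mod_cast (by omega)
    have hdeg : (cQ f (i+2)).degree = (cfA f (i+1) * cQ f (i+1)).degree := by
      simp only [cQ]
      exact degree_add_eq_left_of_degree_lt (h3.trans hd)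
    refine ⟨?_, ?_, ?_⟩
    · intro h0
      rw [show i + 1 + 1 = i + 2 from rfl] at h0
      rw [h0, degree_zero, eq_comm, degree_eq_bot] at hdeg
      exact hm hdeg
    · rw [show i + 1 + 1 = i + 2 from rfl, natDegree_eq_of_degree_eq hdeg, natDegree_mul hA h1, h2,
        cD_succ]
      rw [add_comm]; rfl
    · rw [show i + 1 + 1 = i + 2 from rfl, hdeg]; exact hd

/-- `x` is an `r`-gap position -/
def Gap (r : ℕ) (f : LaurentSeries K) (x : ℕ) : Prop :=
  ∃ Q P : K[X], Q ≠ 0 ∧ Q.natDegree + r ≤ x ∧ oge ((x : ℤ) + 1) (pt Q * f - pt P)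

lemma gap_iff {f : LaurentSeries K} (h : Irr f) (r i x : ℕ) (hx1 : cD f i ≤ x)
    (hx2 : x < cD f (i+1)) : Gap r f x ↔ cD f i + r ≤ x := by
  constructor
  · rintro ⟨Q, P, hQ, hdeg, he⟩
    obtain ⟨hq, hqd, -⟩ := cQ_deg h i
    have hz : Q * cP f (i+1) - P * cQ f (i+1) = 0 := by
      apply pt_zero_of_oge
      have : pt (Q * cP f (i+1) - P * cQ f (i+1))
          = (pt Q * f - pt P) * pt (cQ f (i+1)) - pt Q * cE f (i+1) := by
        simp only [cE, pt, map_sub, map_mul]; ring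
      rw [this]
      apply oge.sub
      · refine (he.mul (pt_oge _)).mono ?_
        rw [hqd]; omega
      · refine ((pt_oge _).mul (oge_order _)).mono ?_
        rw [(cE_order h (i+1)).2]; omega
    have hcop : IsCoprime (cQ f (i+1)) (cP f (i+1)) := by
      refine ⟨(-1)^i * cP f i, -(-1)^i * cQ f i, ?_⟩
      have := cdet f i
      have h2 : ((-1 : K[X]) ^ i) * (-1) ^ i = 1 := by rw [← mul_pow]; simp
      linear_combination (-1) ^ i * this + h2
    have hdvd : cQ f (i+1) ∣ Q := by
      apply hcop.dvd_of_dvd_mul_right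
      exact ⟨P, by linear_combination hz⟩
    have := natDegree_le_of_dvd hdvd hQ
    omega
  · intro hr
    refine ⟨cQ f (i+1), cP f (i+1), (cQ_deg h i).1, by rw [(cQ_deg h i).2.1]; exact hr, ?_⟩
    have := oge_order (cE f (i+1))
    rw [(cE_order h (i+1)).2] at this
    exact this.mono (by omega)

/-- number of gaps below `M` -/
def gapCount (r : ℕ) (f : LaurentSeries K) (M : ℕ) : ℕ :=
  ((Finset.range M).filter (fun x => Gap r f x)).card

lemma gapCount_cD {f : LaurentSeries K} (h : Irr f) (r I : ℕ) :
    gapCount r f (cD f I) = ∑ i ∈ Finset.range I, (cfa f (i+1) - r) := by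
  induction I with
  | zero => simp [gapCount, cD]
  | succ I ih =>
    rw [Finset.sum_range_succ, ← ih]
    have hle : cD f I ≤ cD f (I+1) := by rw [cD_succ]; omega
    have hsplit : (Finset.range (cD f (I+1))).filter (fun x => Gap r f x)
        = (Finset.range (cD f I)).filter (fun x => Gap r f x) ∪
          Finset.Ico (cD f I + r) (cD f (I+1)) := by
      ext x
      simp only [Finset.mem_filter, Finset.mem_range, Finset.mem_union, Finset.mem_Ico]
      constructor
      · rintro ⟨hx, hg⟩
        by_cases hxI : x < cD f I
        · exact Or.inl ⟨hxI, hg⟩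
        · exact Or.inr ⟨(gap_iff h r I x (by omega) hx).1 hg, hx⟩
      · rintro (⟨hx, hg⟩ | ⟨hx, hg⟩)
        · exact ⟨by omega, hg⟩
        · exact ⟨hg, (gap_iff h r I x (by omega) hg).2 hx⟩
    unfold gapCount
    rw [hsplit, Finset.card_union_of_disjoint, Nat.card_Ico, cD_succ]
    · omega
    · rw [Finset.disjoint_left]
      intro x hx hx2
      simp only [Finset.mem_filter, Finset.mem_range, Finset.mem_Ico] at hx hx2
      omega


/-- quadratic over polynomials -/
def Quad (f : LaurentSeries K) : Prop :=
  ∃ a b c : K[X], a ≠ 0 ∧ pt a * f ^ 2 + pt b * f + pt c = 0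

lemma Quad.mul_t {f : LaurentSeries K} (h : Quad f) (k : ℕ) : Quad (tLS K ^ k * f) := by
  obtain ⟨a, b, c, ha, he⟩ := h
  refine ⟨a, b * X ^ k, c * X ^ (2 * k), ha, ?_⟩
  simp only [pt, map_mul, map_pow, aeval_X] at he ⊢
  linear_combination (tLS K ^ (2 * k)) * he

lemma finite_natDegree_le [Finite K] (N : ℕ) : {Q : K[X] | Q.natDegree ≤ N}.Finite := by
  have h1 : Finite (Polynomial.degreeLT K (N+1)) :=
    Finite.of_equiv _ (Polynomial.degreeLTEquiv K (N+1)).toEquiv.symm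
  have h2 : (Polynomial.degreeLT K (N+1) : Set K[X]).Finite := Set.toFinite _
  refine h2.subset ?_
  intro Q hQ
  simp only [SetLike.mem_coe, Polynomial.mem_degreeLT]
  exact lt_of_le_of_lt degree_le_natDegree (by exact_mod_cast Nat.lt_succ_of_le hQ)

lemma finite_quad_roots (S : Set K[X]) (hS : S.Finite) :
    {α : LaurentSeries K | ∃ a ∈ S, ∃ b ∈ S, ∃ c ∈ S, (a ≠ 0 ∨ b ≠ 0 ∨ c ≠ 0) ∧
      pt a * α ^ 2 + pt b * α + pt c = 0}.Finite := by
  have key : ∀ a b c : K[X], {α : LaurentSeries K | (a ≠ 0 ∨ b ≠ 0 ∨ c ≠ 0) ∧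
      pt a * α ^ 2 + pt b * α + pt c = 0}.Finite := by
    intro a b c
    by_cases h : a ≠ 0 ∨ b ≠ 0 ∨ c ≠ 0
    · set R : Polynomial (LaurentSeries K) := Polynomial.C (pt a) * X ^ 2 + Polynomial.C (pt b) * X
        + Polynomial.C (pt c) with hR
      have hR0 : R ≠ 0 := by
        intro h0
        rcases h with h | h | h
        · apply pt_ne h
          have := congrArg (fun q => Polynomial.coeff q 2) h0
          simpa [hR, coeff_X, coeff_C] using this
        · apply pt_ne h
          have := congrArg (fun q => Polynomial.coeff q 1) h0
          simpa [hR, coeff_X, coeff_C] using this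
        · apply pt_ne h
          have := congrArg (fun q => Polynomial.coeff q 0) h0
          simpa [hR, coeff_X, coeff_C] using this
      refine (Polynomial.finite_setOfPred_isRoot hR0).subset ?_
      rintro α ⟨-, hα⟩
      simpa [hR, IsRoot] using hα
    · convert Set.finite_empty
      ext α; simp only [Set.mem_ofPred_eq, Set.mem_empty_iff_false, iff_false]; tauto
  refine ((hS.biUnion fun a _ => hS.biUnion fun b _ => hS.biUnion fun c _ => key a b c)).subset ?_
  rintro α ⟨a, ha, b, hb, c, hc, h⟩
  simp only [Set.mem_iUnion]
  exact ⟨a, ha, b, hb, c, hc, h⟩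

lemma cfQuot_add (f : LaurentSeries K) (i n : ℕ) : cfQuot f (i + n) = cfQuot (cfQuot f i) n := by
  induction n with
  | zero => rfl
  | succ n ih => rw [← add_assoc]; simp only [cfQuot]; rw [ih]

lemma exists_window [Finite K] {f : LaurentSeries K} (h : Irr f) (hq : Quad f) :
    ∃ s : ℕ × ℕ, PeriodWindow f s.1 s.2 := by
  obtain ⟨a, b, c, ha, he⟩ := hq
  obtain ⟨N, hN1, hN2⟩ : ∃ N : ℕ, oge (-(N : ℤ)) (pt a) ∧ oge (-(N : ℤ)) (2 * pt a * f + pt b) := by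
    refine ⟨a.natDegree + (-(2 * pt a * f + pt b).order).toNat, ?_, ?_⟩
    · exact (pt_oge a).mono (by push_cast; omega)
    · exact (oge_order _).mono (by push_cast; omega)
  have hfin := finite_quad_roots _ (finite_natDegree_le (K := K) N)
  set T := {α : LaurentSeries K | ∃ a ∈ {Q : K[X] | Q.natDegree ≤ N},
    ∃ b ∈ {Q : K[X] | Q.natDegree ≤ N}, ∃ c ∈ {Q : K[X] | Q.natDegree ≤ N},
    (a ≠ 0 ∨ b ≠ 0 ∨ c ≠ 0) ∧ pt a * α ^ 2 + pt b * α + pt c = 0} with hT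
  have hmem : ∀ i, cfQuot f (i+1) ∈ T := by
    intro i
    have hE := cE_rel h i
    have o1 : oge (cD f i) (cE f (i+1)) := by
      have := oge_order (cE f (i+1)); rw [(cE_order h (i+1)).2, cD_succ] at this
      exact this.mono (by push_cast; omega)
    have o0 : oge (cD f i) (cE f i) := by
      have := oge_order (cE f i); rwa [(cE_order h i).2] at this
    have q1 : oge (-(cD f i : ℤ)) (pt (cQ f (i+1))) := by
      have := pt_oge (cQ f (i+1)); rwa [(cQ_deg h i).2.1] at this
    have q0 : oge (-(cD f i : ℤ)) (pt (cQ f i)) := by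
      refine (pt_oge (cQ f i)).mono ?_
      have := natDegree_le_natDegree (cQ_deg h i).2.2.le
      rw [(cQ_deg h i).2.1] at this
      omega
    have hdet := cdet f i
    set P1 := cP f (i+1)
    set P0 := cP f i
    set Q1 := cQ f (i+1)
    set Q0 := cQ f i
    set E1 := cE f (i+1) with hE1
    set E0 := cE f i with hE0
    set α := cfQuot f (i+1)
    have p1 : pt P1 = pt Q1 * f - E1 := by rw [hE1, cE]; ring
    have p0 : pt P0 = pt Q0 * f - E0 := by rw [hE0, cE]; ring
    have m : ∀ {u v : LaurentSeries K}, oge (cD f i) u → oge (cD f i) v → oge 0 (u * v) :=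
      fun hu hv => (hu.mul hv).mono (by omega)
    have m' : ∀ {u v : LaurentSeries K}, oge (-(cD f i : ℤ)) u → oge (cD f i) v → oge 0 (u * v) :=
      fun hu hv => (hu.mul hv).mono (by omega)
    have mn : ∀ {u v : LaurentSeries K}, oge (-(N : ℤ)) u → oge 0 v → oge (-(N:ℤ)) (u * v) :=
      fun hu hv => (hu.mul hv).mono (by omega)
    refine ⟨a * P1 ^ 2 + b * P1 * Q1 + c * Q1 ^ 2, ?_,
      2 * a * P1 * P0 + b * (P1 * Q0 + P0 * Q1) + 2 * c * Q1 * Q0, ?_,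
      a * P0 ^ 2 + b * P0 * Q0 + c * Q0 ^ 2, ?_, ?_, ?_⟩
    · apply natDegree_le_of_oge
      have : pt (a * P1 ^ 2 + b * P1 * Q1 + c * Q1 ^ 2)
        = pt a * (E1 * E1) - (2 * pt a * f + pt b) * (pt Q1 * E1) := by
        simp only [pt, map_add, map_mul, map_pow] at p1 he ⊢
        rw [p1]; linear_combination ((aeval (tLS K) Q1) ^ 2) * he
      rw [this]
      exact (mn hN1 (m o1 o1)).sub (mn hN2 (m' q1 o1))
    · apply natDegree_le_of_oge
      have : pt (2 * a * P1 * P0 + b * (P1 * Q0 + P0 * Q1) + 2 * c * Q1 * Q0)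
        = pt a * (E1 * E0 + E1 * E0) - (2 * pt a * f + pt b) * (pt Q1 * E0 + pt Q0 * E1) := by
        simp only [pt, map_add, map_mul, map_ofNat] at p1 p0 he ⊢
        rw [p1, p0]; linear_combination 2 * (aeval (tLS K) Q1) * (aeval (tLS K) Q0) * he
      rw [this]
      exact (mn hN1 ((m o1 o0).add (m o1 o0))).sub (mn hN2 ((m' q1 o0).add (m' q0 o1)))
    · apply natDegree_le_of_oge
      have : pt (a * P0 ^ 2 + b * P0 * Q0 + c * Q0 ^ 2)
        = pt a * (E0 * E0) - (2 * pt a * f + pt b) * (pt Q0 * E0) := by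
        simp only [pt, map_add, map_mul, map_pow] at p0 he ⊢
        rw [p0]; linear_combination ((aeval (tLS K) Q0) ^ 2) * he
      rw [this]
      exact (mn hN1 (m o0 o0)).sub (mn hN2 (m' q0 o0))
    · by_contra hcon
      push Not at hcon
      obtain ⟨h1, h2, h3⟩ := hcon
      have : a * (Q1 * P0 - P1 * Q0) ^ 2 = 0 := by
        linear_combination Q0 ^ 2 * h1 - Q0 * Q1 * h2 + Q1 ^ 2 * h3
      rw [hdet] at this
      simp [ha] at this
    · simp only [pt, map_add, map_mul, map_pow, map_ofNat] at p1 p0 he ⊢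
      rw [p1, p0, hE]
      linear_combination ((aeval (tLS K) Q1 * α + aeval (tLS K) Q0) ^ 2) * he
  have : Finite T := hfin
  obtain ⟨i, j, hij, hEq⟩ := Finite.exists_ne_map_eq_of_infinite (fun i : ℕ => (⟨_, hmem i⟩ : T))
  simp only [Subtype.mk.injEq] at hEq
  wlog hlt : i < j generalizing i j
  · exact this j i hij.symm hEq.symm (by omega)
  refine ⟨(i, j - i), by simp; omega, ?_⟩
  intro n hn
  simp only at hn ⊢
  unfold cfPQ
  obtain ⟨m, rfl⟩ : ∃ m, n = i + 1 + m := ⟨n - (i+1), by omega⟩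
  rw [show i + 1 + m + (j - i) = (j + 1) + m by omega, cfQuot_add, cfQuot_add f (i+1), hEq]


lemma ofPS_neg (F : PowerSeries K) {m : ℤ} (hm : m < 0) :
    (HahnSeries.ofPowerSeries ℤ K F).coeff m = 0 := by
  rw [HahnSeries.ofPowerSeries_apply]
  apply HahnSeries.embDomain_of_notMem_range
  rintro ⟨n, hn⟩
  simp at hn; omega

lemma ofPS_oge (F : PowerSeries K) : oge 0 (HahnSeries.ofPowerSeries ℤ K F) :=
  oge_coeff fun _ hm => ofPS_neg F hm

lemma exists_ofPS {f : LaurentSeries K} (h : oge 0 f) :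
    ∃ F : PowerSeries K, HahnSeries.ofPowerSeries ℤ K F = f := by
  refine ⟨PowerSeries.mk fun n => f.coeff n, ?_⟩
  ext m
  rcases lt_or_ge m 0 with hm | hm
  · rw [ofPS_neg _ hm, h.coeff hm]
  · obtain ⟨n, rfl⟩ := Int.eq_ofNat_of_zero_le hm
    rw [HahnSeries.ofPowerSeries_apply_coeff, PowerSeries.coeff_mk]

lemma single_eq_zpow (n : ℤ) : (HahnSeries.single n (1 : K) : LaurentSeries K) = (tLS K) ^ (-n) := by
  have h1 : ∀ m : ℕ, (tLS K) ^ m = HahnSeries.single (-(m : ℤ)) (1 : K) := by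
    intro m; rw [tLS, HahnSeries.single_pow]; simp
  rcases Int.eq_nat_or_neg n with ⟨m, rfl | rfl⟩
  · rw [zpow_neg, zpow_natCast, h1, HahnSeries.inv_single]; simp
  · rw [neg_neg, zpow_natCast, h1]

lemma exists_phi (P : K[X]) (hP : 1 ≤ P.natDegree) :
    ∃ φ : LaurentSeries K →+* LaurentSeries K, (∀ f, φ f = substLS f P) ∧ φ (tLS K) = pt P ∧
      (∀ a : K, φ (algebraMap K _ a) = algebraMap K _ a) ∧ (∀ f, oge 1 f → oge 1 (φ f)) := by
  have hP0 : P ≠ 0 := by rintro rfl; simp at hP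
  set w := (pt P)⁻¹ with hw
  have hw0 : w ≠ 0 := inv_ne_zero (pt_ne hP0)
  have hwo : w.order = P.natDegree := by rw [hw, order_inv' (pt_ne hP0), pt_order hP0]; simp
  have hw1 : oge 1 w := by rw [oge_iff hw0, hwo]; exact_mod_cast hP
  obtain ⟨W, hW⟩ := exists_ofPS (hw1.mono (by norm_num : (0:ℤ) ≤ 1))
  have hWc : PowerSeries.constantCoeff W = 0 := by
    rw [← PowerSeries.coeff_zero_eq_constantCoeff_apply,
      ← HahnSeries.ofPowerSeries_apply_coeff (Γ := ℤ), hW]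
    exact hw1.coeff (by norm_num)
  have hs : PowerSeries.HasSubst W := PowerSeries.HasSubst.of_constantCoeff_zero' hWc
  set ψ : PowerSeries K →+* LaurentSeries K :=
    (HahnSeries.ofPowerSeries ℤ K).comp (PowerSeries.substAlgHom (R := K) hs).toRingHom with hψ
  have hψa : ∀ F, ψ F = HahnSeries.ofPowerSeries ℤ K (F.subst W) := by
    intro F
    rw [hψ, ← PowerSeries.coe_substAlgHom hs]; rfl
  have hψX : ψ PowerSeries.X = w := by
    rw [hψa, PowerSeries.subst_X hs, hW]
  have hψC : ∀ a : K, ψ (PowerSeries.C a) = algebraMap K _ a := by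
    intro a
    rw [hψ]
    simp only [RingHom.coe_comp, Function.comp_apply]
    have : (PowerSeries.substAlgHom (R := K) hs).toRingHom (PowerSeries.C a) = PowerSeries.C a :=
      (PowerSeries.substAlgHom (R := K) hs).commutes a
    rw [this, algC, HahnSeries.ofPowerSeries_C]
  have hu : ∀ y : Submonoid.powers (PowerSeries.X : PowerSeries K), IsUnit (ψ y) := by
    rintro ⟨_, n, rfl⟩
    simp only [map_pow, hψX]
    exact (pow_ne_zero _ hw0).isUnit
  set φ : LaurentSeries K →+* LaurentSeries K := IsLocalization.lift hu with hφ
  have hφo : ∀ F, φ (HahnSeries.ofPowerSeries ℤ K F) = ψ F := by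
    intro F; exact IsLocalization.lift_eq hu F
  have hφt : φ (tLS K) = pt P := by
    have h1 : tLS K = (HahnSeries.ofPowerSeries ℤ K PowerSeries.X)⁻¹ := by
      rw [HahnSeries.ofPowerSeries_X, single_eq_zpow]; simp
    rw [h1, map_inv₀, hφo, hψX, hw, inv_inv]
  refine ⟨φ, ?_, hφt, ?_, ?_⟩
  · intro f
    conv_lhs => rw [← LaurentSeries.single_order_mul_powerSeriesPart f]
    rw [map_mul, single_eq_zpow, map_zpow₀, hφt, substLS, zpow_neg, ← inv_zpow]
    congr 1
    rw [hφo, hψa]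
    congr 1
    ext n
    rw [PowerSeries.coeff_subst' hs, PowerSeries.coeff_mk,
      finsum_eq_sum_of_support_subset (s := Finset.range (n+1))]
    · apply Finset.sum_congr rfl
      intro j hj
      rw [smul_eq_mul, LaurentSeries.powerSeriesPart_coeff,
        ← HahnSeries.ofPowerSeries_apply_coeff (Γ := ℤ), map_pow, hW]
    · intro j hj
      simp only [Function.mem_support, smul_eq_mul] at hj
      by_contra hjn
      apply hj
      simp only [Finset.coe_range, Set.mem_Iio, not_lt] at hjn
      rw [← HahnSeries.ofPowerSeries_apply_coeff (Γ := ℤ) (W ^ j), map_pow, hW,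
        (hw1.pow j).coeff (by omega), mul_zero]
  · intro a
    rw [algC, ← HahnSeries.ofPowerSeries_C, hφo, hψC, algC, HahnSeries.ofPowerSeries_C]
  · intro f hf
    have h1 : oge 0 (tLS K * f) := by
      have := (oge_order (tLS K)).mul hf
      rw [tLS_order] at this
      exact this.mono (by norm_num)
    obtain ⟨F, hF⟩ := exists_ofPS h1
    have h2 : pt P * φ f = ψ F := by rw [← hφo, hF, map_mul, hφt]
    have h3 : φ f = w * ψ F := by
      rw [← h2, hw, ← mul_assoc, inv_mul_cancel₀ (pt_ne hP0), one_mul]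
    rw [h3, hψa]
    exact (hw1.mul (ofPS_oge _)).mono (by norm_num)

lemma phi_pt {φ : LaurentSeries K →+* LaurentSeries K} {P : K[X]} (ht : φ (tLS K) = pt P)
    (ha : ∀ a : K, φ (algebraMap K _ a) = algebraMap K _ a) (A : K[X]) :
    φ (pt A) = pt (A.comp P) := by
  have h1 : φ.comp (algebraMap K (LaurentSeries K)) = algebraMap K (LaurentSeries K) :=
    RingHom.ext ha
  rw [pt, pt, aeval_comp, aeval_def, aeval_def, hom_eval₂, h1, ht]

lemma phi_cf {φ : LaurentSeries K →+* LaurentSeries K} {P : K[X]} (ht : φ (tLS K) = pt P)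
    (ha : ∀ a : K, φ (algebraMap K _ a) = algebraMap K _ a) (ho : ∀ f, oge 1 f → oge 1 (φ f))
    (f : LaurentSeries K) (i : ℕ) : cfQuot (φ f) i = φ (cfQuot f i) ∧
      cfPQ (φ f) i = pt ((cfA f i).comp P) := by
  have key : ∀ g : LaurentSeries K, ∀ A, polyPart g = pt A → polyPart (φ g) = pt (A.comp P) := by
    intro g A hA
    apply polyPart_eq
    have := ho _ (polyPart_oge g)
    rwa [hA, map_sub, phi_pt ht ha] at this
  have hq : ∀ i, cfQuot (φ f) i = φ (cfQuot f i) := by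
    intro i
    induction i with
    | zero => rfl
    | succ i ih =>
      rw [cfQuot_succ f, map_inv₀, map_sub, phi_pt ht ha, ← key _ _ (cfA_spec f i)]
      simp only [cfQuot]; rw [ih]
  refine ⟨hq i, ?_⟩
  rw [cfPQ, hq]
  exact key _ _ (cfA_spec f i)

lemma comp_inj {P : K[X]} (hP : 1 ≤ P.natDegree) {A B : K[X]} (h : A.comp P = B.comp P) : A = B := by
  have h1 : (A - B).comp P = 0 := by rw [sub_comp, h, sub_self]
  rw [comp_eq_zero_iff] at h1
  rcases h1 with h1 | ⟨-, h1⟩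
  · exact sub_eq_zero.1 h1
  · rw [h1] at hP; simp at hP

lemma phi_window {φ : LaurentSeries K →+* LaurentSeries K} {P : K[X]} (hP : 1 ≤ P.natDegree)
    (ht : φ (tLS K) = pt P)
    (ha : ∀ a : K, φ (algebraMap K _ a) = algebraMap K _ a) (ho : ∀ f, oge 1 f → oge 1 (φ f))
    (f : LaurentSeries K) (m ℓ : ℕ) : PeriodWindow (φ f) m ℓ ↔ PeriodWindow f m ℓ := by
  unfold PeriodWindow
  refine and_congr_right fun _ => forall_congr' fun i => imp_congr_right fun _ => ?_
  rw [(phi_cf ht ha ho f _).2, (phi_cf ht ha ho f _).2, cfA_spec, cfA_spec]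
  constructor
  · intro h; rw [comp_inj hP (pt_inj h)]
  · intro h; rw [pt_inj h]

lemma phi_deg {φ : LaurentSeries K →+* LaurentSeries K} {P : K[X]} (hP : 1 ≤ P.natDegree)
    (ht : φ (tLS K) = pt P)
    (ha : ∀ a : K, φ (algebraMap K _ a) = algebraMap K _ a) (ho : ∀ f, oge 1 f → oge 1 (φ f))
    {f : LaurentSeries K} (hf : Irr f) (i : ℕ) :
    degZ (cfPQ (φ f) (i+1)) = (P.natDegree * cfa f (i+1) : ℕ) := by
  rw [(phi_cf ht ha ho f _).2, degZ, pt_order, natDegree_comp, neg_neg, mul_comm, cfa]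
  intro h0
  exact (cfA_order hf i).1 (comp_inj hP (by rw [h0, zero_comp]))


lemma sum_periodic (h : ℕ → ℕ) (m ℓ : ℕ) (hp : ∀ i, m + 1 ≤ i → h (i + ℓ) = h i) (J : ℕ) :
    ∑ i ∈ Finset.range (m + J * ℓ), h (i+1) =
      ∑ i ∈ Finset.range m, h (i+1) + J * ∑ i ∈ Finset.Ico (m+1) (m+1+ℓ), h i := by
  have hp2 : ∀ J i, m + 1 ≤ i → h (i + J * ℓ) = h i := by
    intro J
    induction J with
    | zero => intro i _; simp
    | succ J ih =>
      intro i hi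
      rw [show i + (J+1) * ℓ = (i + J * ℓ) + ℓ by ring, hp _ (by omega), ih i hi]
  induction J with
  | zero => simp
  | succ J ih =>
    rw [show m + (J+1) * ℓ = (m + J * ℓ) + ℓ by ring, Finset.sum_range_add, ih, add_mul, one_mul,
      ← add_assoc]
    congr 1
    rw [Finset.sum_Ico_eq_sum_range]
    simp only [add_tsub_cancel_left]
    apply Finset.sum_congr rfl
    intro j _
    rw [← hp2 J (m+1+j) (by omega)]; congr 1; ring

lemma cfa_periodic {f : LaurentSeries K} (h : Irr f) {m ℓ : ℕ} (hw : PeriodWindow f m ℓ) :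
    ∀ i, m + 1 ≤ i → cfa f (i + ℓ) = cfa f i := by
  intro i hi
  have h1 := congrArg degZ (hw.2 i hi)
  obtain ⟨j, rfl⟩ : ∃ j, i = j + 1 := ⟨i - 1, by omega⟩
  rw [show j + 1 + ℓ = (j + ℓ) + 1 by ring, degZ_cfPQ h, degZ_cfPQ h] at h1
  rw [show j + 1 + ℓ = (j + ℓ) + 1 by ring]
  exact_mod_cast h1

lemma arch {x C : ℝ} (h : ∀ J : ℕ, J * x ≤ C) : x ≤ 0 := by
  by_contra hx
  push Not at hx
  obtain ⟨n, hn⟩ := exists_nat_gt (C / x)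
  rw [div_lt_iff₀ hx] at hn
  linarith [h n]

lemma window_sums {f : LaurentSeries K} (h : Irr f) {m ℓ : ℕ} (hw : PeriodWindow f m ℓ) (r : ℕ)
    (J : ℕ) :
    cD f (m + J * ℓ) = cD f m + J * ∑ i ∈ Finset.Ico (m+1) (m+1+ℓ), cfa f i ∧
    gapCount r f (cD f (m + J * ℓ)) = gapCount r f (cD f m) +
      J * ∑ i ∈ Finset.Ico (m+1) (m+1+ℓ), (cfa f i - r) := by
  have hp := cfa_periodic h hw
  refine ⟨sum_periodic (cfa f) m ℓ hp J, ?_⟩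
  rw [gapCount_cD h, gapCount_cD h]
  exact sum_periodic (fun i => cfa f i - r) m ℓ (fun i hi => by rw [hp i hi]) J

lemma window_lower {f : LaurentSeries K} (h : Irr f) {m ℓ : ℕ} (hw : PeriodWindow f m ℓ) (r : ℕ)
    (γ C : ℝ) (hC : ∀ M : ℕ, γ * M - C ≤ gapCount r f M) :
    γ * (∑ i ∈ Finset.Ico (m+1) (m+1+ℓ), cfa f i : ℕ) ≤
      (∑ i ∈ Finset.Ico (m+1) (m+1+ℓ), (cfa f i - r) : ℕ) := by
  rw [← sub_nonpos]
  apply arch (C := gapCount r f (cD f m) + C - γ * cD f m)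
  intro J
  have h1 := hC (cD f (m + J * ℓ))
  rw [(window_sums h hw r J).2, (window_sums h hw r J).1] at h1
  rw [Nat.cast_add, Nat.cast_add, Nat.cast_mul, Nat.cast_mul] at h1
  linarith

lemma window_upper {f : LaurentSeries K} (h : Irr f) {m ℓ : ℕ} (hw : PeriodWindow f m ℓ) (r : ℕ)
    (γ C : ℝ) (hC : ∀ M : ℕ, (gapCount r f M : ℝ) ≤ γ * M + C) :
    ((∑ i ∈ Finset.Ico (m+1) (m+1+ℓ), (cfa f i - r) : ℕ) : ℝ) ≤
    γ * (∑ i ∈ Finset.Ico (m+1) (m+1+ℓ), cfa f i : ℕ) := by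
  rw [← sub_nonpos]
  apply arch (C := γ * cD f m + C - gapCount r f (cD f m))
  intro J
  have h1 := hC (cD f (m + J * ℓ))
  rw [(window_sums h hw r J).2, (window_sums h hw r J).1] at h1
  rw [Nat.cast_add, Nat.cast_add, Nat.cast_mul, Nat.cast_mul] at h1
  linarith

lemma eMass_phi [Finite K] {φ : LaurentSeries K →+* LaurentSeries K} {P : K[X]}
    (hP : 1 ≤ P.natDegree) (ht : φ (tLS K) = pt P)
    (ha : ∀ a : K, φ (algebraMap K _ a) = algebraMap K _ a) (ho : ∀ f, oge 1 f → oge 1 (φ f))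
    {f : LaurentSeries K} (hf : Irr f) (hq : Quad f) :
    ∃ m ℓ, PeriodWindow f m ℓ ∧ 0 < ∑ i ∈ Finset.Ico (m+1) (m+1+ℓ), cfa f i ∧
    ∀ n, eMassOf (φ f) n =
      (∑ i ∈ Finset.Ico (m+1) (m+1+ℓ), max ((P.natDegree : ℝ) * cfa f i - n) 0) /
      (P.natDegree * (∑ i ∈ Finset.Ico (m+1) (m+1+ℓ), cfa f i : ℕ)) := by
  have hex : ∃ s : ℕ × ℕ, PeriodWindow (φ f) s.1 s.2 := by
    obtain ⟨s, hs⟩ := exists_window hf hq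
    exact ⟨s, (phi_window hP ht ha ho f _ _).2 hs⟩
  have hw := (phi_window hP ht ha ho f _ _).1 (Classical.choose_spec hex)
  refine ⟨_, _, hw, ?_, ?_⟩
  · apply Finset.sum_pos
    · intro i hi
      rw [Finset.mem_Ico] at hi
      obtain ⟨j, rfl⟩ : ∃ j, i = j + 1 := ⟨i - 1, by omega⟩
      exact cfa_pos hf j
    · have := hw.1
      simp; omega
  · intro n
    unfold eMassOf
    rw [dif_pos hex]
    have key : ∀ i ∈ Finset.Ico ((Classical.choose hex).1 + 1)
        ((Classical.choose hex).1 + 1 + (Classical.choose hex).2),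
        (degZ (cfPQ (φ f) i) : ℝ) = P.natDegree * cfa f i := by
      intro i hi
      rw [Finset.mem_Ico] at hi
      obtain ⟨j, rfl⟩ : ∃ j, i = j + 1 := ⟨i - 1, by omega⟩
      rw [phi_deg hP ht ha ho hf]; push_cast; ring
    congr 1
    · exact Finset.sum_congr rfl fun i hi => by rw [key i hi]
    · rw [Finset.sum_congr rfl key, ← Finset.mul_sum]; push_cast; rfl

lemma main_abstract [Finite K] {Θ : LaurentSeries K} (hΘ : Irr Θ) (hq : Quad Θ) {P : K[X]}
    (hP : 1 ≤ P.natDegree) {c : ℝ}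
    (hlow : ∀ r : ℕ, 1 ≤ r → ∀ ε > (0:ℝ), ∀ᶠ k in atTop, ∃ C : ℝ, ∀ M : ℕ,
      (c - ε) * M - C ≤ gapCount r (tLS K ^ k * Θ) M)
    (hup : ∃ᶠ k in atTop, ∃ C : ℝ, ∀ M : ℕ, (gapCount 2 (tLS K ^ k * Θ) M : ℝ) ≤ c * M + C) :
    ExhibitsExactEscape (Polynomial.aeval (tLS K) P) (substLS Θ P) c := by
  obtain ⟨φ, hφ, ht, ha, ho⟩ := exists_phi P hP
  have hd0 : (0:ℝ) < P.natDegree := by exact_mod_cast hP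
  have hE : ∀ k n, eMassP (Polynomial.aeval (tLS K) P) (substLS Θ P) k n
      = eMassOf (φ (tLS K ^ k * Θ)) n := by
    intro k n
    rw [eMassP, map_mul, map_pow, ht, hφ]
  unfold ExhibitsExactEscape
  simp_rw [hE]
  apply tendsto_nhds_of_eventually_eq
  filter_upwards [eventually_ge_atTop (2 * P.natDegree)] with n hn
  have hbd : ∀ k, 0 ≤ eMassOf (φ (tLS K ^ k * Θ)) n ∧ eMassOf (φ (tLS K ^ k * Θ)) n ≤ 1 := by
    intro k
    obtain ⟨m, ℓ, -, hpos, he⟩ := eMass_phi hP ht ha ho (hΘ.mul_t k) (hq.mul_t k)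
    rw [he]
    have hpos' : (0:ℝ) < (∑ i ∈ Finset.Ico (m+1) (m+1+ℓ), cfa (tLS K ^ k * Θ) i : ℕ) := by
      exact_mod_cast hpos
    constructor
    · apply div_nonneg (Finset.sum_nonneg fun i _ => le_max_right _ _) (by positivity)
    · rw [div_le_one (by positivity)]
      push_cast
      rw [Finset.mul_sum]
      apply Finset.sum_le_sum
      intro i _
      apply max_le
      · linarith [Nat.cast_nonneg (α := ℝ) n]
      · positivity
  have hb1 : IsBoundedUnder (· ≥ ·) atTop (fun k => eMassOf (φ (tLS K ^ k * Θ)) n) :=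
    isBoundedUnder_of ⟨0, fun k => (hbd k).1⟩
  have hb2 : IsBoundedUnder (· ≤ ·) atTop (fun k => eMassOf (φ (tLS K ^ k * Θ)) n) :=
    isBoundedUnder_of ⟨1, fun k => (hbd k).2⟩
  apply le_antisymm
  · apply liminf_le_of_frequently_le _ hb1
    refine hup.mono ?_
    rintro k ⟨C, hC⟩
    obtain ⟨m, ℓ, hw, hpos, he⟩ := eMass_phi hP ht ha ho (hΘ.mul_t k) (hq.mul_t k)
    have h1 := window_upper (hΘ.mul_t k) hw 2 c C hC
    have hpos' : (0:ℝ) < (∑ i ∈ Finset.Ico (m+1) (m+1+ℓ), cfa (tLS K ^ k * Θ) i : ℕ) := by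
      exact_mod_cast hpos
    rw [he, div_le_iff₀ (by positivity)]
    calc (∑ i ∈ Finset.Ico (m+1) (m+1+ℓ), max ((P.natDegree : ℝ) * cfa (tLS K ^ k * Θ) i - n) 0)
        ≤ ∑ i ∈ Finset.Ico (m+1) (m+1+ℓ), (P.natDegree : ℝ) * (cfa (tLS K ^ k * Θ) i - 2 : ℕ) := by
          apply Finset.sum_le_sum
          intro i _
          apply max_le _ (by positivity)
          have h2 : (cfa (tLS K ^ k * Θ) i : ℝ) ≤ (cfa (tLS K ^ k * Θ) i - 2 : ℕ) + 2 := by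
            exact_mod_cast (by omega)
          have h3 : (2:ℝ) * P.natDegree ≤ n := by exact_mod_cast hn
          nlinarith
      _ = P.natDegree * (∑ i ∈ Finset.Ico (m+1) (m+1+ℓ), (cfa (tLS K ^ k * Θ) i - 2) : ℕ) := by
          rw [← Finset.mul_sum, Nat.cast_sum]
      _ ≤ _ := by
          have := mul_le_mul_of_nonneg_left h1 hd0.le
          linarith
  · apply le_of_forall_pos_sub_le
    intro ε hε
    apply le_liminf_of_le hb2.isCoboundedUnder_ge
    filter_upwards [hlow (n+1) (by omega) ε hε] with k hk
    obtain ⟨C, hC⟩ := hk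
    obtain ⟨m, ℓ, hw, hpos, he⟩ := eMass_phi hP ht ha ho (hΘ.mul_t k) (hq.mul_t k)
    have h1 := window_lower (hΘ.mul_t k) hw (n+1) (c - ε) C hC
    have hpos' : (0:ℝ) < (∑ i ∈ Finset.Ico (m+1) (m+1+ℓ), cfa (tLS K ^ k * Θ) i : ℕ) := by
      exact_mod_cast hpos
    rw [he, le_div_iff₀ (by positivity)]
    calc (c - ε) * (P.natDegree * (∑ i ∈ Finset.Ico (m+1) (m+1+ℓ), cfa (tLS K ^ k * Θ) i : ℕ))
        ≤ P.natDegree * (∑ i ∈ Finset.Ico (m+1) (m+1+ℓ), (cfa (tLS K ^ k * Θ) i - (n+1)) : ℕ) := by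
          have := mul_le_mul_of_nonneg_left h1 hd0.le
          linarith
      _ = ∑ i ∈ Finset.Ico (m+1) (m+1+ℓ), (P.natDegree : ℝ) * (cfa (tLS K ^ k * Θ) i - (n+1) : ℕ) := by
          rw [← Finset.mul_sum, Nat.cast_sum]
      _ ≤ _ := by
          apply Finset.sum_le_sum
          intro i _
          rcases le_total (cfa (tLS K ^ k * Θ) i) (n+1) with h2 | h2
          · rw [Nat.sub_eq_zero_of_le h2]; simp
          · refine le_trans ?_ (le_max_left _ _)
            rw [Nat.cast_sub h2, mul_sub]
            have h3 : (1:ℝ) ≤ P.natDegree := by exact_mod_cast hP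
            push_cast
            nlinarith [Nat.cast_nonneg (α := ℝ) n]


lemma count_block (p : ℕ → Prop) {lo a1 b1 a2 b2 hi : ℕ} (h1 : lo ≤ a1) (h2 : b1 ≤ a2)
    (h3 : b2 ≤ hi) (h4 : b1 ≤ hi) (h5 : lo ≤ a2) (hp1 : ∀ x, a1 ≤ x → x < b1 → p x)
    (hp2 : ∀ x, a2 ≤ x → x < b2 → p x) :
    (b1 - a1) + (b2 - a2) ≤ ((Finset.Ico lo hi).filter p).card := by
  rw [← Nat.card_Ico, ← Nat.card_Ico, ← Finset.card_union_of_disjoint]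
  · apply Finset.card_le_card
    intro x hx
    simp only [Finset.mem_union, Finset.mem_Ico, Finset.mem_filter] at hx ⊢
    rcases hx with ⟨u, v⟩ | ⟨u, v⟩
    · exact ⟨⟨by omega, by omega⟩, hp1 x u v⟩
    · exact ⟨⟨by omega, by omega⟩, hp2 x u v⟩
  · rw [Finset.disjoint_left]
    intro x hx hx2
    simp only [Finset.mem_Ico] at hx hx2
    omega

lemma count_lower (p : ℕ → Prop) (L w : ℕ) (hL : 0 < L)
    (hb : ∀ b, w ≤ ((Finset.Ico (L * b) (L * b + L)).filter p).card) (M : ℕ) :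
    (w / L : ℝ) * M - w ≤ ((Finset.range M).filter p).card := by
  have h1 : ∀ n, n * w ≤ ((Finset.range (L * n)).filter p).card := by
    intro n
    induction n with
    | zero => simp
    | succ n ih =>
      have : Finset.range (L * (n+1)) = Finset.range (L * n) ∪ Finset.Ico (L * n) (L * n + L) := by
        ext x; simp only [Finset.mem_range, Finset.mem_union, Finset.mem_Ico, mul_add, mul_one]
        omega
      rw [this, Finset.filter_union, Finset.card_union_of_disjoint]
      · have := hb n; rw [add_mul]; omega
      · rw [Finset.disjoint_left]
        intro x hx hx2
        simp only [Finset.mem_filter, Finset.mem_range, Finset.mem_Ico] at hx hx2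
        omega
  have h2 : M / L * w ≤ ((Finset.range M).filter p).card := by
    refine (h1 (M / L)).trans (Finset.card_le_card (Finset.filter_subset_filter _ ?_))
    exact Finset.range_subset_range.2 (Nat.mul_div_le M L)
  have h3 : (M : ℝ) ≤ (M / L : ℕ) * L + L := by
    have := Nat.lt_div_mul_add (a := M) hL
    exact_mod_cast this.le
  have hL' : (0:ℝ) < L := by exact_mod_cast hL
  have h4 : ((M / L : ℕ) : ℝ) * w ≤ (((Finset.range M).filter p).card : ℝ) := by exact_mod_cast h2
  refine le_trans ?_ h4
  have h5 : (w / L : ℝ) * M ≤ (w / L : ℝ) * ((M / L : ℕ) * L + L) :=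
    mul_le_mul_of_nonneg_left h3 (by positivity)
  have h6 : (w / L : ℝ) * ((M / L : ℕ) * L + L) = (M / L : ℕ) * w + w := by field_simp
  linarith

lemma count_upper (p : ℕ → Prop) (L w : ℕ) (hL : 0 < L) (hw : w ≤ L)
    (hp : ∀ x, p x → ∃ μ : ℕ, L * μ < x + w ∧ x ≤ L * μ) (M : ℕ) :
    (((Finset.range M).filter p).card : ℝ) ≤ (w / L : ℝ) * M + 2 * w := by
  have h1 : ((Finset.range M).filter p).card ≤ (M / L + 2) * w := by
    have hsub : (Finset.range M).filter p ⊆ (Finset.range (M / L + 2)).biUnion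
        (fun μ => Finset.Ico (L * μ + 1 - w) (L * μ + 1)) := by
      intro x hx
      simp only [Finset.mem_filter, Finset.mem_range] at hx
      obtain ⟨μ, h1, h2⟩ := hp x hx.2
      simp only [Finset.mem_biUnion, Finset.mem_range, Finset.mem_Ico]
      refine ⟨μ, ?_, by omega, by omega⟩
      by_contra hcon
      push Not at hcon
      have h3 : L * (M / L + 2) ≤ L * μ := Nat.mul_le_mul_left _ hcon
      have h4 := Nat.lt_div_mul_add (a := M) hL
      rw [mul_add, mul_comm L (M / L)] at h3
      omega
    refine (Finset.card_le_card hsub).trans (Finset.card_biUnion_le.trans ?_)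
    refine (Finset.sum_le_card_nsmul _ _ w ?_).trans ?_
    · intro μ _; rw [Nat.card_Ico]; omega
    · simp
  have h2 : (((Finset.range M).filter p).card : ℝ) ≤ ((M / L : ℕ) + 2) * w := by exact_mod_cast h1
  have h3 : ((M / L : ℕ) : ℝ) ≤ M / L := Nat.cast_div_le
  refine h2.trans ?_
  have := mul_le_mul_of_nonneg_right h3 (Nat.cast_nonneg (α := ℝ) w)
  have h4 : (w / L : ℝ) * M = M / L * w := by ring
  rw [h4]; linarith

/-- Pade type lemma -/
lemma pade {n N : ℕ} (hn : 1 ≤ n) (hN : n ≤ N) {G h Φ : K[X]} (hG : G.natDegree < n)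
    (hh : h.natDegree < n) (hdvd : expand K n Φ ∣ G + X ^ N * h) (hne : G + X ^ N * h ≠ 0) :
    ∃ i M : ℕ, ∃ a b : K, i < n ∧ N ≤ n * M + i ∧ n * M + i < N + n ∧ (a ≠ 0 ∨ b ≠ 0) ∧
      Φ ∣ X * (C a + C b * X ^ M) := by
  obtain ⟨S, hS⟩ := hdvd
  -- pick a residue class where something is nonzero
  obtain ⟨e, he⟩ : ∃ e, (G + X ^ N * h).coeff e ≠ 0 := by
    by_contra hcon; push Not at hcon; exact hne (Polynomial.ext (by simpa using hcon))
  have hcoef : ∀ e, (G + X ^ N * h).coeff e =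
      (if e < n then G.coeff e else 0) + (if N ≤ e ∧ e < N + n then h.coeff (e - N) else 0) := by
    intro e
    rw [coeff_add, coeff_X_pow_mul']
    congr 1
    · split_ifs with h1
      · rfl
      · exact coeff_eq_zero_of_natDegree_lt (by omega)
    · split_ifs with h1 h2 h2
      · rfl
      · exact coeff_eq_zero_of_natDegree_lt (by omega)
      · omega
      · rfl
  set i := e % n with hi
  have hin : i < n := Nat.mod_lt _ (by omega)
  obtain ⟨M, hM1, hM2⟩ : ∃ M, N ≤ n * M + i ∧ n * M + i < N + n := by
    refine ⟨(N + n - 1 - i) / n, ?_, ?_⟩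
    · have := Nat.lt_div_mul_add (a := N + n - 1 - i) (b := n) (by omega)
      rw [mul_comm] at this; omega
    · have := Nat.mul_div_le (N + n - 1 - i) n
      omega
  have hM0 : 1 ≤ M := by
    by_contra h0
    have : M = 0 := by omega
    subst this; simp at hM1; omega
  have hid : contract n (X ^ (n - i) * (G + X ^ N * h)) =
      X * (C ((G + X ^ N * h).coeff i) + C ((G + X ^ N * h).coeff (n * M + i)) * X ^ M) := by
    ext j
    rw [coeff_contract (by omega), coeff_X_pow_mul']
    rcases j with _ | j
    · rw [if_neg (by omega)]; simp
    · have e1 : (j + 1) * n - (n - i) = n * j + i := by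
        rw [add_mul, one_mul, mul_comm j n]; omega
      have e0 : n - i ≤ (j+1) * n := by rw [add_mul, one_mul]; omega
      rw [if_pos e0, e1, coeff_X_mul, coeff_add (C _), coeff_C, coeff_C_mul, coeff_X_pow]
      by_cases hj0 : j = 0
      · subst hj0
        rw [if_pos rfl, if_neg (by omega)]; simp
      · rw [if_neg hj0]
        by_cases hjM : j = M
        · subst hjM; simp
        · rw [if_neg hjM]
          simp only [mul_zero, add_zero]
          rw [hcoef]
          have h1 : n ≤ n * j := Nat.le_mul_of_pos_right _ (by omega)
          rw [if_neg (by omega), if_neg]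
          · simp
          rintro ⟨u1, u2⟩
          rcases Nat.lt_or_gt_of_ne hjM with hlt | hlt
          · have : n * (j+1) ≤ n * M := Nat.mul_le_mul_left _ hlt
            rw [mul_add] at this; omega
          · have : n * (M+1) ≤ n * j := Nat.mul_le_mul_left _ hlt
            rw [mul_add] at this; omega
  refine ⟨i, M, (G + X ^ N * h).coeff i, (G + X ^ N * h).coeff (n * M + i), hin, hM1, hM2, ?_, ?_⟩
  · have hee : e = n * (e / n) + i := (Nat.div_add_mod e n).symm
    by_cases h0 : e / n = 0
    · left
      rw [h0] at hee; simp only [mul_zero, zero_add] at hee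
      rwa [← hee]
    · right
      have h1 : n ≤ n * (e / n) := Nat.le_mul_of_pos_right _ (Nat.pos_of_ne_zero h0)
      have h2 : N ≤ e ∧ e < N + n := by
        by_contra h2
        rw [hcoef, if_neg (by omega), if_neg h2] at he
        simp at he
      have h3 : e / n = M := by
        by_contra hjM
        rcases Nat.lt_or_gt_of_ne hjM with hlt | hlt
        · have : n * (e / n +1) ≤ n * M := Nat.mul_le_mul_left _ hlt
          rw [mul_add] at this; omega
        · have : n * (M+1) ≤ n * (e / n) := Nat.mul_le_mul_left _ hlt
          rw [mul_add] at this; omega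
      rw [← h3, ← hee]; exact he
  · rw [← hid, hS]
    refine ⟨contract n (X ^ (n - i) * S), ?_⟩
    rw [show X ^ (n - i) * (expand K n Φ * S) = (X ^ (n - i) * S) * expand K n Φ by ring,
      contract_mul_expand (by omega)]
    ring

/-- homogenization -/
def homg (T : K[X]) (m : ℕ) (Q : K[X]) : K[X] :=
  ∑ i ∈ Finset.range (m+1), C (Q.coeff i) * T ^ i * X ^ (m - i)

lemma homg_aeval {T : K[X]} {m : ℕ} {Q : K[X]} {z τ : LaurentSeries K} (hQ : Q.natDegree ≤ m)
    (hz : aeval z T = z * τ) : aeval z (homg T m Q) = z ^ m * aeval τ Q := by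
  rw [homg, map_sum, aeval_eq_sum_range' (n := m+1) (by omega), Finset.mul_sum]
  apply Finset.sum_congr rfl
  intro i hi
  rw [Finset.mem_range] at hi
  simp only [map_mul, map_pow, aeval_C, aeval_X, hz]
  rw [Algebra.smul_def, show z ^ m = z ^ i * z ^ (m - i) by rw [← pow_add]; congr 1; omega]
  ring

lemma homg_natDegree {T : K[X]} (hT : T.natDegree ≤ 2) (m : ℕ) (Q : K[X]) :
    (homg T m Q).natDegree ≤ 2 * m := by
  apply natDegree_sum_le_of_forall_le
  intro i hi
  rw [Finset.mem_range] at hi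
  refine (natDegree_mul_le).trans ?_
  refine (Nat.add_le_add ((natDegree_C_mul_le _ _).trans (natDegree_pow_le)) (natDegree_X_pow_le _)).trans ?_
  have := Nat.mul_le_mul_left i hT
  omega


lemma ps_pow_prime (p : ℕ) [Fact p.Prime] (F : PowerSeries (ZMod p)) (n : ℕ) :
    PowerSeries.coeff n (F ^ p) = if p ∣ n then PowerSeries.coeff (n / p) F else 0 := by
  have hp : p ≠ 0 := (Fact.out : p.Prime).ne_zero
  have h := MvPowerSeries.map_frobenius_expand (σ := Unit) (R := ZMod p) p hp (f := F)
  rw [ZMod.frobenius_zmod, MvPowerSeries.map_id] at h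
  have h2 : F ^ p = PowerSeries.expand p hp F := by
    rw [PowerSeries.expand]; exact h.symm
  rw [h2, PowerSeries.coeff_expand]

lemma cantor_rec (p : ℕ) [Fact p.Prime] (n : ℕ) :
    cantor p n = if n % p % 2 = 1 then 0 else
      (((p - 1) / 2).choose ((n % p) / 2) : ZMod p) * cantor p (n / p) := by
  have hp : 1 < p := (Fact.out : p.Prime).one_lt
  rcases n with _ | n
  · simp [cantor]
  · rw [cantor, dif_pos hp]

lemma cantor_ps (p : ℕ) [Fact p.Prime] (hodd : Odd p) :
    (PowerSeries.mk (cantor p)) = (1 + PowerSeries.X ^ 2) ^ ((p - 1) / 2) *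
      (PowerSeries.mk (cantor p)) ^ p := by
  obtain ⟨h, hh⟩ := hodd
  have hp : 1 < p := (Fact.out : p.Prime).one_lt
  have hh2 : (p - 1) / 2 = h := by omega
  ext n
  rw [PowerSeries.coeff_mk, cantor_rec, hh2, add_comm, add_pow, Finset.sum_mul, map_sum]
  have hterm : ∀ j ∈ Finset.range (h+1),
      PowerSeries.coeff n ((PowerSeries.X ^ 2) ^ j * 1 ^ (h - j) * (h.choose j : PowerSeries (ZMod p)) *
        (PowerSeries.mk (cantor p)) ^ p) =
      if 2 * j = n % p then (h.choose j : ZMod p) * cantor p (n / p) else 0 := by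
    intro j hj
    rw [Finset.mem_range] at hj
    rw [one_pow, mul_one, ← pow_mul, mul_assoc, PowerSeries.coeff_X_pow_mul',
      ← map_natCast (PowerSeries.C (R := ZMod p)), PowerSeries.coeff_C_mul, ps_pow_prime,
      PowerSeries.coeff_mk]
    have hdm := Nat.div_add_mod n p
    have hml := Nat.mod_lt n (show 0 < p by omega)
    by_cases h1 : 2 * j = n % p
    · have e1 : n - 2 * j = p * (n / p) := by omega
      have e2 : 2 * j ≤ n := by have := Nat.mod_le n p; omega
      rw [if_pos h1, if_pos e2, e1, if_pos (dvd_mul_right _ _), Nat.mul_div_cancel_left _ (by omega)]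
    · rw [if_neg h1]
      split_ifs with h2 h3
      · exfalso
        obtain ⟨c, hc⟩ := h3
        apply h1
        have : n = 2 * j + p * c := by omega
        rw [this, Nat.add_mul_mod_self_left, Nat.mod_eq_of_lt (by omega)]
      · simp
      · rfl
  rw [Finset.sum_congr rfl hterm]
  split_ifs with h1
  · symm; apply Finset.sum_eq_zero
    intro j _; rw [if_neg (by omega)]
  · rw [Finset.sum_eq_single (n % p / 2)]
    · rw [if_pos (by omega)]
    · intro j _ hj; rw [if_neg (by omega)]
    · intro hj
      have hml := Nat.mod_lt n (show 0 < p by omega)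
      exfalso; apply hj; rw [Finset.mem_range]; omega

lemma cantor_sq (p : ℕ) [Fact p.Prime] (hodd : Odd p) :
    (1 + PowerSeries.X ^ 2) * (PowerSeries.mk (cantor p)) ^ 2 = 1 := by
  have hF := cantor_ps p hodd
  have hc : PowerSeries.constantCoeff (PowerSeries.mk (cantor p)) = 1 := by
    rw [← PowerSeries.coeff_zero_eq_constantCoeff_apply, PowerSeries.coeff_mk, cantor]
  obtain ⟨h, hh⟩ := hodd
  have hp : 1 < p := (Fact.out : p.Prime).one_lt
  rw [show (p - 1) / 2 = h by omega] at hF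
  set F := PowerSeries.mk (cantor p)
  have hF0 : F ≠ 0 := by intro h0; rw [h0] at hc; simp at hc
  set Y := (1 + PowerSeries.X ^ 2) * F ^ 2 with hY
  have h1 : Y ^ h = 1 := by
    apply mul_right_cancel₀ hF0
    rw [one_mul]
    conv_rhs => rw [hF]
    rw [hY, mul_pow, ← pow_mul, mul_assoc, ← pow_succ]
    exact congrArg (fun n => (1 + PowerSeries.X ^ 2) ^ h * F ^ n) hh.symm
  have h2 := mul_geom_sum Y h
  rw [h1, sub_self, mul_eq_zero] at h2
  rcases h2 with h2 | h2
  · exact sub_eq_zero.1 h2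
  · exfalso
    have h3 := congrArg PowerSeries.constantCoeff h2
    have hYc : PowerSeries.constantCoeff Y = 1 := by rw [hY]; simp [hc]
    simp only [map_sum, map_pow, hYc, one_pow, map_zero, Finset.sum_const, Finset.card_range,
      nsmul_eq_mul, mul_one] at h3
    rw [ZMod.natCast_eq_zero_iff] at h3
    have := Nat.le_of_dvd (by omega) h3
    omega

lemma t_mul_single : tLS K * HahnSeries.single (1:ℤ) 1 = 1 := by
  rw [tLS, HahnSeries.single_mul_single]; simp

lemma cantor_facts (p : ℕ) [Fact p.Prime] (hodd : Odd p) :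
    (cantorTheta p) ^ 2 * (tLS (ZMod p) ^ 2 + 1) = 1 ∧
      oge 1 (1 - tLS (ZMod p) * cantorTheta p) := by
  have h0 := t_mul_single (K := ZMod p)
  have h1 := congrArg (HahnSeries.ofPowerSeries ℤ (ZMod p)) (cantor_sq p hodd)
  simp only [map_mul, map_add, map_one, map_pow, HahnSeries.ofPowerSeries_X] at h1
  set s : LaurentSeries (ZMod p) := HahnSeries.single (1:ℤ) 1 with hs
  have hC : tLS (ZMod p) * cantorTheta p = cantorTilde p := by
    rw [cantorTheta, ← mul_assoc, h0, one_mul]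
  constructor
  · rw [cantorTheta]
    change (1 + s ^ 2) * (cantorTilde p) ^ 2 = 1 at h1
    linear_combination h1 + cantorTilde p ^ 2 * (tLS (ZMod p) * s + 1) * h0
  · rw [hC]
    apply oge_coeff
    intro m hm
    rw [HahnSeries.coeff_sub, cantorTilde]
    rcases lt_or_ge m 0 with h | h
    · rw [ofPS_neg _ h, HahnSeries.coeff_one, if_neg (by omega), sub_zero]
    · have : m = ((0:ℕ) : ℤ) := by push_cast; omega
      rw [this, HahnSeries.ofPowerSeries_apply_coeff, PowerSeries.coeff_mk, cantor]
      simp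

lemma irr_of_sq (h2 : (2 : K) ≠ 0) {V : K[X]} (hV : 1 ≤ V.natDegree) {y : LaurentSeries K}
    (hy : y ^ 2 * (pt V ^ 2 + 1) = 1) : Irr y := by
  intro Q P hQ he
  have hpoly : P ^ 2 * (V ^ 2 + 1) = Q ^ 2 := by
    apply pt_inj
    simp only [pt, map_mul, map_pow, map_add, map_one] at he hy ⊢
    rw [← he]; linear_combination (aeval (tLS K) Q) ^ 2 * hy
  have hP : P ≠ 0 := by
    rintro rfl
    simp only [ne_eq, OfNat.ofNat_ne_zero, not_false_eq_true, zero_pow, zero_mul] at hpoly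
    exact pow_ne_zero 2 hQ hpoly.symm
  obtain ⟨s, hs⟩ : P ∣ Q := by
    rw [← IsIntegrallyClosed.pow_dvd_pow_iff two_ne_zero]
    exact ⟨_, hpoly.symm⟩
  have hs2 : V ^ 2 + 1 = s ^ 2 := by
    apply mul_left_cancel₀ (pow_ne_zero 2 hP)
    rw [hpoly, hs]; ring
  have hprod : (s - V) * (s + V) = 1 := by linear_combination -hs2
  have u1 : (s - V).natDegree = 0 := natDegree_eq_zero_of_isUnit (IsUnit.of_mul_eq_one _ hprod)
  have u2 : (s + V).natDegree = 0 :=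
    natDegree_eq_zero_of_isUnit (IsUnit.of_mul_eq_one _ ((mul_comm _ _).trans hprod))
  have h3 : (C (2:K) * V).natDegree = 0 := by
    have : C (2:K) * V = (s + V) - (s - V) := by rw [map_ofNat]; ring
    rw [this]
    have := natDegree_sub_le (s + V) (s - V)
    omega
  rw [natDegree_C_mul h2] at h3
  omega

lemma two_ne (p : ℕ) [Fact p.Prime] (hodd : Odd p) : (2 : ZMod p) ≠ 0 := by
  intro h
  have h1 : ((2:ℕ) : ZMod p) = 0 := by exact_mod_cast h
  rw [ZMod.natCast_eq_zero_iff] at h1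
  have := Nat.le_of_dvd (by omega) h1
  have hp : 1 < p := (Fact.out : p.Prime).one_lt
  have : p = 2 := by omega
  subst this
  exact absurd hodd (by decide)

lemma cantor_R (p : ℕ) [Fact p.Prime] (hodd : Odd p) :
    ∃ R u v : LaurentSeries (ZMod p), cantorTheta p * R = 1 ∧ R ^ 2 = tLS _ ^ 2 + 1 ∧
      u = tLS _ + R ∧ v = R - tLS _ ∧ u * v = 1 ∧ u ≠ 0 ∧ v ≠ 0 ∧ u.order = -1 ∧ v.order = 1 ∧
      R ≠ 0 ∧ R.order = -1 := by
  obtain ⟨h1, h2⟩ := cantor_facts p hodd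
  set Θ := cantorTheta p
  set t := tLS (ZMod p) with ht
  have hΘ : Θ ≠ 0 := by intro h0; rw [h0] at h1; simp at h1
  have hΘR : Θ * Θ⁻¹ = 1 := mul_inv_cancel₀ hΘ
  have hR2 : (Θ⁻¹) ^ 2 = t ^ 2 + 1 := by
    field_simp; linear_combination -h1
  set R := Θ⁻¹ with hR
  have hRne : R ≠ 0 := inv_ne_zero hΘ
  have hto : t.order = -1 := tLS_order
  have ho : Θ.order = 1 := by
    have h3 : t * Θ = 1 + -(1 - t * Θ) := by ring
    have h4 := order_add_left (f := (1 : LaurentSeries (ZMod p))) one_ne_zero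
      (g := -(1 - t * Θ)) (by rw [HahnSeries.order_one]; exact h2.neg)
    rw [← h3, HahnSeries.order_one, HahnSeries.order_mul tLS_ne hΘ, hto] at h4
    omega
  have hRo : R.order = -1 := by rw [hR, order_inv' hΘ, ho]
  have huv : (t + R) * (R - t) = 1 := by linear_combination hR2
  have hvo : oge 0 (R - t) := by
    have : R - t = (1 - t * Θ) * R := by linear_combination t * hΘR
    rw [this]
    have h5 := h2.mul (oge_order R)
    rw [hRo] at h5
    exact h5.mono (by norm_num)
  have h2t : pt (C (2 : ZMod p) * X) = 2 * t := by
    simp only [pt, map_mul, aeval_X, map_ofNat, ht]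
  have hC : (C (2 : ZMod p) * X) ≠ 0 :=
    mul_ne_zero (by simpa using two_ne p hodd) X_ne_zero
  have hu : t + R ≠ 0 ∧ (t + R).order = -1 := by
    have h3 : t + R = pt (C (2 : ZMod p) * X) + (R - t) := by rw [h2t]; ring
    have ho2 : (pt (C (2 : ZMod p) * X)).order = -1 := by
      rw [pt_order hC, natDegree_C_mul_X _ (two_ne p hodd)]; simp
    have h4 := order_add_left (pt_ne hC) (g := R - t) (by rw [ho2]; exact hvo)
    rw [← h3, ho2] at h4
    exact h4
  have hv : R - t = (t + R)⁻¹ := by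
    rw [eq_comm, inv_eq_iff_eq_inv, eq_comm]; exact inv_eq_of_mul_eq_one_left huv
  refine ⟨R, t + R, R - t, hΘR, hR2, rfl, rfl, huv, hu.1, ?_, hu.2, ?_, hRne, hRo⟩
  · rw [hv]; exact inv_ne_zero hu.1
  · rw [hv, order_inv' hu.1, hu.2]; rfl


lemma oge_pow_order {z : LaurentSeries K} (n : ℕ) : oge (n * z.order) (z ^ n) :=
  (oge_order z).pow n

lemma cantor_level (p : ℕ) [Fact p.Prime] (hodd : Odd p) (j : ℕ)
    {R u v : LaurentSeries (ZMod p)} (hR2 : R ^ 2 = tLS _ ^ 2 + 1)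
    (hu : u = tLS _ + R) (hv : v = R - tLS _) (s : ℕ) :
    ∃ a b : (ZMod p)[X], pt a + pt b * R = v ^ (p ^ j * s) ∧
      pt a - pt b * R = (-u) ^ (p ^ j * s) ∧
      ((Even s ∧ X ^ (p ^ j) ∣ b) ∨ (¬ Even s ∧ X ^ (p ^ j) ∣ a)) := by
  have hqodd : Odd (p ^ j) := hodd.pow
  obtain ⟨h, hh⟩ := hqodd
  have : CharP (LaurentSeries (ZMod p)) p :=
    charP_of_injective_algebraMap (algebraMap (ZMod p) (LaurentSeries (ZMod p))).injective p
  have hRq : R ^ (p ^ j) = R * (tLS _ ^ 2 + 1) ^ h := by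
    rw [← hR2, ← pow_mul, ← pow_succ', hh]
  set q := p ^ j with hq
  have hvq : v ^ q = R * (tLS _ ^ 2 + 1) ^ h - tLS _ ^ q := by
    rw [hv, hq, sub_pow_char_pow, ← hq, hRq]
  have huq : (-u) ^ q = -(R * (tLS _ ^ 2 + 1) ^ h) - tLS _ ^ q := by
    rw [hu, show -(tLS (ZMod p) + R) = -R - tLS _ by ring, hq, sub_pow_char_pow, ← hq,
      Odd.neg_pow ⟨h, hh⟩, hRq]
  induction s with
  | zero => exact ⟨1, 0, by simp, by simp, Or.inl ⟨by simp, by simp⟩⟩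
  | succ s ih =>
    obtain ⟨a, b, h1, h2, h3⟩ := ih
    refine ⟨-a * X ^ q + b * (X ^ 2 + 1) ^ h * (X ^ 2 + 1), a * (X ^ 2 + 1) ^ h - b * X ^ q, ?_, ?_, ?_⟩
    · rw [show q * (s + 1) = q * s + q by ring, pow_add, ← h1, hvq]
      simp only [pt, map_add, map_sub, map_mul, map_neg, map_pow, map_one, aeval_X]
      linear_combination -(aeval (tLS (ZMod p)) b) * (tLS _ ^ 2 + 1) ^ h * hR2
    · rw [show q * (s + 1) = q * s + q by ring, pow_add, ← h2, huq]
      simp only [pt, map_add, map_sub, map_mul, map_neg, map_pow, map_one, aeval_X]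
      linear_combination -(aeval (tLS (ZMod p)) b) * (tLS _ ^ 2 + 1) ^ h * hR2
    · rcases h3 with ⟨he, hb⟩ | ⟨he, ha⟩
      · right
        refine ⟨by rw [Nat.even_add_one]; simpa using he, ?_⟩
        exact dvd_add (dvd_mul_left _ _) (Dvd.dvd.mul_right (Dvd.dvd.mul_right hb _) _)
      · left
        refine ⟨by rw [Nat.even_add_one]; exact he, ?_⟩
        exact dvd_sub (Dvd.dvd.mul_right ha _) (dvd_mul_left _ _)

lemma cantor_level' (p : ℕ) [Fact p.Prime] (hodd : Odd p) (j : ℕ)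
    {R u v : LaurentSeries (ZMod p)} (hR2 : R ^ 2 = tLS _ ^ 2 + 1)
    (hu : u = tLS _ + R) (hv : v = R - tLS _) (hv0 : v ≠ 0) (huo : u.order = -1)
    (hvo : v.order = 1) (hR0 : R ≠ 0) (hRo : R.order = -1) (s : ℕ) :
    ∃ a b : (ZMod p)[X], X ^ (p ^ j) ∣ a ∧ pt a + pt b * R ≠ 0 ∧
      oge ((p ^ j * s : ℕ) - 1) (pt a + pt b * R) ∧
      oge (-((p ^ j * s : ℕ) : ℤ) - 1) (pt a - pt b * R) := by
  obtain ⟨a, b, h1, h2, h3⟩ := cantor_level p hodd j hR2 hu hv s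
  have o1 := oge_pow_order (z := v) (p ^ j * s)
  have o2 := oge_pow_order (z := -u) (p ^ j * s)
  rw [hvo] at o1
  rw [HahnSeries.order_neg, huo] at o2
  have oR := oge_order R
  rw [hRo] at oR
  rcases h3 with ⟨he, hb⟩ | ⟨he, ha⟩
  · refine ⟨b * (X ^ 2 + 1), a, Dvd.dvd.mul_right hb _, ?_⟩
    have e1 : pt (b * (X ^ 2 + 1)) + pt a * R = v ^ (p ^ j * s) * R := by
      rw [← h1]
      simp only [pt, map_add, map_mul, map_pow, map_one, aeval_X]
      linear_combination -(aeval (tLS (ZMod p)) b) * hR2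
    have e2 : pt (b * (X ^ 2 + 1)) - pt a * R = -((-u) ^ (p ^ j * s) * R) := by
      rw [← h2]
      simp only [pt, map_add, map_mul, map_pow, map_one, aeval_X]
      linear_combination -(aeval (tLS (ZMod p)) b) * hR2
    rw [e1, e2]
    refine ⟨mul_ne_zero (pow_ne_zero _ hv0) hR0, (o1.mul oR).mono ?_, (o2.mul oR).neg.mono ?_⟩
    · push_cast; linarith
    · push_cast; linarith
  · refine ⟨a, b, ha, ?_⟩
    rw [h1, h2]
    refine ⟨pow_ne_zero _ hv0, o1.mono ?_, o2.mono ?_⟩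
    · push_cast; linarith
    · push_cast; linarith

lemma cantor_gap (p : ℕ) [Fact p.Prime] (hodd : Odd p) (j s ρ k r x : ℕ)
    (hk : k ≤ p ^ j + ρ) (h1 : p ^ j * s + ρ + 1 + r ≤ x + k) (h2 : x + ρ < p ^ j * s) :
    Gap r (tLS (ZMod p) ^ k * cantorTheta p) x := by
  obtain ⟨R, u, v, hΘR, hR2, hu, hv, huv, hu0, hv0, huo, hvo, hR0, hRo⟩ := cantor_R p hodd
  obtain ⟨a, b, ⟨a', ha'⟩, hne, oe, oe'⟩ :=
    cantor_level' p hodd j hR2 hu hv hv0 huo hvo hR0 hRo s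
  have hΘ0 : cantorTheta p ≠ 0 := left_ne_zero_of_mul_eq_one hΘR
  have hΘo : oge 1 (cantorTheta p) := by
    have := HahnSeries.order_mul hΘ0 hR0
    rw [hΘR, HahnSeries.order_one, hRo] at this
    rw [oge_iff hΘ0]; omega
  set Θ := cantorTheta p
  set t := tLS (ZMod p) with ht
  obtain ⟨c, hc⟩ : ∃ c, p ^ j + ρ = k + c := ⟨p ^ j + ρ - k, by omega⟩
  set Q : (ZMod p)[X] := X ^ c * a' with hQ
  have hQa : X ^ k * Q = a * X ^ ρ := by
    rw [hQ, ha', ← mul_assoc, ← pow_add, ← hc, pow_add]; ring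
  have herr : pt Q * (t ^ k * Θ) - pt (-b * X ^ ρ) = (pt a + pt b * R) * (t ^ ρ * Θ) := by
    have := congrArg pt hQa
    simp only [pt, map_mul, map_pow, aeval_X, map_neg, ← ht] at this ⊢
    linear_combination Θ * this - aeval t b * t ^ ρ * hΘR
  have hto : oge (-(ρ : ℤ)) (t ^ ρ) := by
    have := oge_pow_order (z := t) ρ
    rw [ht, tLS_order] at this; exact this.mono (by linarith)
  have oerr : oge ((x:ℤ) + 1) (pt Q * (t ^ k * Θ) - pt (-b * X ^ ρ)) := by
    rw [herr]
    refine (oe.mul (hto.mul hΘo)).mono ?_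
    omega
  have hQ0 : Q ≠ 0 := by
    intro h0
    rw [h0] at oerr
    have h3 : -b * X ^ ρ = 0 := by
      apply pt_zero_of_oge
      have := oerr.neg
      simp only [pt, map_zero, zero_mul, zero_sub, neg_neg] at this
      exact this.mono (by omega)
    rw [h0, h3] at herr
    have h4 : (pt a + pt b * R) * (t ^ ρ * Θ) ≠ 0 :=
      mul_ne_zero hne (mul_ne_zero (pow_ne_zero _ tLS_ne) hΘ0)
    apply h4; rw [← herr]; simp
  refine ⟨Q, -b * X ^ ρ, hQ0, ?_, oerr⟩
  have hda : a.natDegree ≤ p ^ j * s + 1 := by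
    have h3 : (C (2 : ZMod p) * a).natDegree ≤ p ^ j * s + 1 := by
      apply natDegree_le_of_oge
      have : pt (C (2 : ZMod p) * a) = (pt a + pt b * R) + (pt a - pt b * R) := by
        simp only [pt, map_mul, map_ofNat]; ring
      rw [this]
      refine (oe.mono ?_).add (oe'.mono ?_) <;> omega
    rwa [natDegree_C_mul (two_ne p hodd)] at h3
  have h4 : k + Q.natDegree = (a * X ^ ρ).natDegree := by
    rw [← hQa, natDegree_mul (pow_ne_zero _ X_ne_zero) hQ0, natDegree_X_pow]
  have h5 : (a * X ^ ρ).natDegree ≤ a.natDegree + ρ :=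
    (natDegree_mul_le).trans (by rw [natDegree_X_pow])
  omega

lemma cantor_low (p : ℕ) [Fact p.Prime] (hodd : Odd p) (r : ℕ) (ε : ℝ) (hε : 0 < ε) :
    ∀ᶠ k in atTop, ∃ C : ℝ, ∀ M : ℕ,
      ((2 / p : ℝ) - ε) * M - C ≤ gapCount r (tLS (ZMod p) ^ k * cantorTheta p) M := by
  have hp1 : 1 < p := (Fact.out : p.Prime).one_lt
  have hp3 : 3 ≤ p := by
    obtain ⟨h, hh⟩ := hodd; omega
  obtain ⟨k0, hk0⟩ := exists_nat_gt (2 * (r + 1) / ε)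
  filter_upwards [eventually_ge_atTop (k0 + 2)] with k hk
  obtain ⟨j, hj1, hj2⟩ : ∃ j, p ^ j < k ∧ k ≤ p ^ (j+1) := by
    refine ⟨Nat.log p (k-1), ?_, ?_⟩
    · have := Nat.pow_log_le_self p (x := k-1) (by omega); omega
    · have := Nat.lt_pow_succ_log_self hp1 (k-1)
      rw [Nat.succ_eq_add_one] at this; omega
  set q := p ^ j with hq
  have hq0 : 0 < q := by positivity
  have hpq : p ^ (j+1) = p * q := by rw [hq, pow_succ]; ring
  rw [hpq] at hj2
  have h3q : 3 * q ≤ p * q := Nat.mul_le_mul_right _ hp3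
  have hblock : ∀ b, 2 * q - 2 * (r+1) ≤ ((Finset.Ico (p * q * b) (p * q * b + p * q)).filter
      (Gap r (tLS (ZMod p) ^ k * cantorTheta p))).card := by
    intro b
    set Y := p * q * b with hY
    refine le_trans ?_ (count_block _ (lo := Y) (a1 := Y + p * q - 2 * q + 1 + r)
      (b1 := Y + p * q - k) (a2 := Y + p * q - k + r + 1) (b2 := Y + p * q) (hi := Y + p * q)
      (by omega) (by omega) (by omega) (by omega) (by omega) ?_ ?_)
    · omega
    · intro x hx1 hx2
      have e : p ^ j * (p * (b+1) - 1) = Y + p * q - q := by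
        rw [← hq, Nat.mul_sub, hY, mul_one]; congr 1; ring
      apply cantor_gap p hodd j (p * (b+1) - 1) (k - q) k r x
      · omega
      · rw [e]; omega
      · rw [e]; omega
    · intro x hx1 hx2
      have e : p ^ (j+1) * (b+1) = Y + p * q := by rw [hpq, hY]; ring
      apply cantor_gap p hodd (j+1) (b+1) 0 k r x
      · omega
      · rw [e]; omega
      · rw [e]; omega
  have hpq0 : 0 < p * q := by positivity
  refine ⟨(2 * q - 2 * (r+1) : ℕ), fun M => ?_⟩
  have hc := count_lower _ _ _ hpq0 hblock M
  refine le_trans ?_ hc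
  apply sub_le_sub_right
  apply mul_le_mul_of_nonneg_right _ (Nat.cast_nonneg _)
  have hL : (0:ℝ) < (p * q : ℕ) := by exact_mod_cast hpq0
  have hpR : (0:ℝ) < p := by positivity
  have hqR : (0:ℝ) < q := by exact_mod_cast hq0
  rw [le_div_iff₀ hL]
  have h1 : (2 * q : ℝ) - 2 * (r+1) ≤ (2 * q - 2 * (r+1) : ℕ) := by
    rw [sub_le_iff_le_add]; exact_mod_cast (by omega)
  refine le_trans ?_ h1
  have h2 : (k0 : ℝ) ≤ (p * q : ℕ) := by exact_mod_cast (by omega)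
  have h3 : 2 * ((r:ℝ) + 1) < k0 * ε := by rwa [div_lt_iff₀ hε] at hk0
  have h4 : k0 * ε ≤ (p * q : ℕ) * ε := mul_le_mul_of_nonneg_right h2 hε.le
  have h5 : (2 / p : ℝ) * (p * q : ℕ) = 2 * q := by push_cast; field_simp
  rw [sub_mul, h5]; linarith


lemma natDegree_le_of_oge_aeval {w : LaurentSeries K} (hw : w.order = -1) {Q : K[X]} {c : ℕ}
    (h : oge (-(c : ℤ)) (aeval w Q)) : Q.natDegree ≤ c := by
  by_cases hQ : Q = 0
  · subst hQ; simp
  · obtain ⟨h1, h2⟩ := order_aeval (by rw [hw]; norm_num) Q hQ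
    have := h.le h1
    rw [h2, hw] at this
    omega

/-- degree bound for numerators -/
lemma num_deg {f : LaurentSeries K} {Q P : K[X]} {D : ℕ} {x : ℕ}
    (hf : oge (-(D:ℤ)) (pt Q * f)) (h : oge ((x:ℤ)+1) (pt Q * f - pt P)) : P.natDegree ≤ D := by
  apply natDegree_le_of_oge
  have : pt P = pt Q * f - (pt Q * f - pt P) := by ring
  rw [this]
  exact hf.sub (h.mono (by omega))

lemma cantor_pade (p : ℕ) [Fact p.Prime] {M : ℕ} {a b : ZMod p} (hab : a ≠ 0 ∨ b ≠ 0)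
    (h : (X - 1 : (ZMod p)[X]) ^ 2 ∣ X * (C a + C b * X ^ M)) : p ∣ M := by
  obtain ⟨S, hS⟩ := h
  have h1 : a + b = 0 := by
    have := congrArg (eval 1) hS
    simpa using this
  have h2 := congrArg (fun f => eval 1 (derivative f)) hS
  simp [derivative_mul, derivative_pow] at h2
  have h3 : b * M = 0 := by linear_combination h2 - h1
  rw [mul_eq_zero] at h3
  rcases h3 with h3 | h3
  · exfalso
    rw [h3, add_zero] at h1
    rcases hab with h | h
    · exact h h1
    · exact h h3
  · rwa [ZMod.natCast_eq_zero_iff] at h3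

lemma cantor_gap_up (p : ℕ) [Fact p.Prime] (hodd : Odd p) (j x : ℕ)
    (hg : Gap 2 (tLS (ZMod p) ^ (2 * p ^ j) * cantorTheta p) x) :
    ∃ μ : ℕ, p * p ^ j * μ < x + 2 * p ^ j ∧ x ≤ p * p ^ j * μ := by
  obtain ⟨R, u, v, hΘR, hR2, hu, hv, huv, hu0, hv0, huo, hvo, hR0, hRo⟩ := cantor_R p hodd
  obtain ⟨Q, P, hQ0, hQd, herr⟩ := hg
  have hp1 : 1 < p := (Fact.out : p.Prime).one_lt
  have hΘ0 : cantorTheta p ≠ 0 := left_ne_zero_of_mul_eq_one hΘR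
  have hΘo : oge 1 (cantorTheta p) := by
    have := HahnSeries.order_mul hΘ0 hR0
    rw [hΘR, HahnSeries.order_one, hRo] at this
    rw [oge_iff hΘ0]; omega
  set Θ := cantorTheta p
  set q := p ^ j with hq
  have hq0 : 0 < q := by positivity
  obtain ⟨k, hk⟩ : ∃ k, k = 2 * q := ⟨_, rfl⟩
  rw [← hk] at herr
  have hto : oge (-(k : ℤ)) (tLS (ZMod p) ^ k) := by
    have := oge_pow_order (z := tLS (ZMod p)) k
    rw [tLS_order] at this; exact this.mono (by linarith)
  have hPd : P.natDegree ≤ Q.natDegree + k := by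
    refine num_deg ?_ herr
    refine ((pt_oge Q).mul (hto.mul hΘo)).mono ?_
    push_cast; omega
  set t := tLS (ZMod p) with ht
  have h2 : (2 : LaurentSeries (ZMod p)) ≠ 0 := by
    have := algebraMap_ne (two_ne p hodd)
    rwa [map_ofNat] at this
  have h2' : (algebraMap (ZMod p) (LaurentSeries (ZMod p)) 2⁻¹) = 2⁻¹ := by
    rw [map_inv₀, map_ofNat]
  set e := pt Q * t ^ k - pt P * R with he
  have heo : oge x e := by
    have : e = (pt Q * (t ^ k * Θ) - pt P) * R := by
      rw [he]; linear_combination -(pt Q * t ^ k) * hΘR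
    rw [this]
    have h3 := herr.mul (oge_order R)
    rw [hRo] at h3
    exact h3.mono (by omega)
  set m := x + k - 1 with hm
  set T : (ZMod p)[X] := C (2⁻¹) * (X ^ 2 - 1) with hT
  set S : (ZMod p)[X] := C (2⁻¹) * (X ^ 2 + 1) with hS
  have hTu : aeval u T = u * t := by
    simp only [hT, map_mul, map_sub, map_pow, map_one, aeval_C, aeval_X, h2']
    field_simp
    rw [hu]; linear_combination hR2
  have hTv : aeval (-v) T = (-v) * t := by
    simp only [hT, map_mul, map_sub, map_pow, map_one, aeval_C, aeval_X, h2']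
    field_simp
    rw [hv]; linear_combination hR2
  have hSu : aeval u S = u * R := by
    simp only [hS, map_mul, map_add, map_pow, map_one, aeval_C, aeval_X, h2']
    field_simp
    rw [hu]; linear_combination -hR2
  have hSv : aeval (-v) S = -((-v) * R) := by
    simp only [hS, map_mul, map_add, map_pow, map_one, aeval_C, aeval_X, h2']
    field_simp
    rw [hv]; linear_combination -hR2
  have hTd : T.natDegree ≤ 2 := by
    rw [hT]; compute_degree
  have hSd : S.natDegree ≤ 2 := by
    rw [hS]; compute_degree
  set A := T ^ k * homg T (m - k) Q with hA
  set B := homg T (m - 1) P * S with hB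
  have hAu : aeval u A = u ^ m * (pt Q * t ^ k) := by
    rw [hA, map_mul, map_pow, hTu, homg_aeval (by omega) hTu,
      show u ^ m = u ^ k * u ^ (m - k) by rw [← pow_add]; congr 1; omega]
    ring
  have hAv : aeval (-v) A = (-v) ^ m * (pt Q * t ^ k) := by
    rw [hA, map_mul, map_pow, hTv, homg_aeval (by omega) hTv,
      show (-v) ^ m = (-v) ^ k * (-v) ^ (m - k) by rw [← pow_add]; congr 1; omega]
    ring
  have hBu : aeval u B = u ^ m * (pt P * R) := by
    rw [hB, map_mul, hSu, homg_aeval (by omega) hTu,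
      show u ^ m = u ^ (m - 1) * u by rw [← pow_succ]; congr 1; omega]
    ring
  have hBv : aeval (-v) B = -((-v) ^ m * (pt P * R)) := by
    rw [hB, map_mul, hSv, homg_aeval (by omega) hTv,
      show (-v) ^ m = (-v) ^ (m - 1) * (-v) by rw [← pow_succ]; congr 1; omega]
    ring
  have hAd : A.natDegree ≤ 2 * m := by
    rw [hA]
    refine natDegree_mul_le.trans ?_
    have e1 := homg_natDegree hTd (m - k) Q
    have e2 := (natDegree_pow_le (p := T) (n := k)).trans (Nat.mul_le_mul_left k hTd)
    omega
  have hBd : B.natDegree ≤ 2 * m := by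
    rw [hB]
    refine natDegree_mul_le.trans ?_
    have e1 := homg_natDegree hTd (m - 1) P
    omega
  have hGd : (A - B).natDegree ≤ k - 1 := by
    apply natDegree_le_of_oge_aeval huo
    rw [map_sub, hAu, hBu, ← mul_sub, ← he]
    have h3 := (oge_pow_order (z := u) m).mul heo
    rw [huo] at h3
    exact h3.mono (by omega)
  obtain ⟨h, hh⟩ : X ^ (2 * x + k - 1) ∣ A + B := by
    apply X_pow_dvd_of_order (w := -v) (by rw [HahnSeries.order_neg, hvo])
    rw [map_add, hAv, hBv, ← sub_eq_add_neg, ← mul_sub, ← he]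
    have h3 := (oge_pow_order (z := -v) m).mul heo
    rw [HahnSeries.order_neg, hvo] at h3
    exact h3.mono (by omega)
  have hhd : h.natDegree ≤ k - 1 := by
    by_cases h0 : h = 0
    · rw [h0]; simp
    have h3 : (A + B).natDegree ≤ 2 * m := natDegree_add_le_of_degree_le hAd hBd
    rw [hh, natDegree_mul (pow_ne_zero _ X_ne_zero) h0, natDegree_X_pow] at h3
    omega
  have hsum : (A - B) + X ^ (2 * x + k - 1) * h = 2 * A := by rw [← hh]; ring
  have hexp : expand (ZMod p) k ((X - 1) ^ 2) = (X ^ 2 - 1) ^ k := by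
    simp only [map_pow, map_sub, expand_X, map_one]
    rw [hk, pow_mul (X : (ZMod p)[X]), hq, pow_mul', sub_pow_char_pow, one_pow]
  have hdvd : expand (ZMod p) k ((X - 1) ^ 2) ∣ (A - B) + X ^ (2 * x + k - 1) * h := by
    rw [hsum, hexp, hA, hT, mul_pow]
    exact ⟨2 * C 2⁻¹ ^ k * homg (C 2⁻¹ * (X ^ 2 - 1)) (m - k) Q, by ring⟩
  have hne : (A - B) + X ^ (2 * x + k - 1) * h ≠ 0 := by
    rw [hsum]
    intro h0
    have h3 := congrArg (aeval u) h0
    rw [map_mul, hAu, map_zero, map_ofNat] at h3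
    exact mul_ne_zero h2 (mul_ne_zero (pow_ne_zero _ hu0)
      (mul_ne_zero (pt_ne hQ0) (pow_ne_zero _ tLS_ne))) h3
  obtain ⟨i, M, a, b, hi, hM1, hM2, hab, hΦ⟩ := pade (n := k) (N := 2 * x + k - 1) (by omega)
    (by omega) (by omega) (by omega) hdvd hne
  obtain ⟨μ, rfl⟩ := cantor_pade p hab hΦ
  refine ⟨μ, ?_⟩
  have e3 : k * (p * μ) = 2 * (p * q * μ) := by rw [hk]; ring
  rw [e3] at hM1 hM2
  constructor <;> omega

lemma cantor_up (p : ℕ) [Fact p.Prime] (hodd : Odd p) :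
    ∃ᶠ k in atTop, ∃ C : ℝ, ∀ M : ℕ,
      (gapCount 2 (tLS (ZMod p) ^ k * cantorTheta p) M : ℝ) ≤ (2 / p : ℝ) * M + C := by
  rw [frequently_atTop]
  intro j
  have hp1 : 1 < p := (Fact.out : p.Prime).one_lt
  have hj : j < p ^ j := Nat.lt_pow_self hp1
  refine ⟨2 * p ^ j, by omega, 2 * (2 * p ^ j : ℕ), fun M => ?_⟩
  have h := count_upper _ (p * p ^ j) (2 * p ^ j) (by positivity) (Nat.mul_le_mul_right _ hp1)
    (cantor_gap_up p hodd j) M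
  have e : (((2 * p ^ j : ℕ) : ℝ) / ((p * p ^ j : ℕ) : ℝ)) = 2 / p := by
    have hpR : (0:ℝ) < p := by positivity
    push_cast; field_simp
  rw [e] at h
  exact h

lemma cantor_final (p : ℕ) [Fact p.Prime] (hodd : Odd p) (P : (ZMod p)[X]) (hP : 1 ≤ P.natDegree) :
    IsQuadIrr (substLS (cantorTheta p) P) ∧
        ExhibitsExactEscape (Polynomial.aeval (tLS (ZMod p)) P) (substLS (cantorTheta p) P)
          (2 / p) := by
  have hsq := (cantor_facts p hodd).1
  obtain ⟨φ, hφ, ht, ha, ho⟩ := exists_phi P hP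
  have hsq2 : (substLS (cantorTheta p) P) ^ 2 * (pt P ^ 2 + 1) = 1 := by
    have := congrArg φ hsq
    rw [map_mul, map_pow, map_add, map_pow, map_one, ht, hφ] at this
    exact this
  have hquad : ∀ V : (ZMod p)[X], 1 ≤ V.natDegree → ∀ y, y ^ 2 * (pt V ^ 2 + 1) = 1 →
      ∃ a b c : (ZMod p)[X], a ≠ 0 ∧ pt a * y ^ 2 + pt b * y + pt c = 0 := by
    intro V hV y hy
    refine ⟨V ^ 2 + 1, 0, -1, ?_, ?_⟩
    · intro h0
      have h1 : pt (V ^ 2 + 1) = 0 := by rw [h0]; simp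
      simp only [pt, map_add, map_pow, map_one] at h1
      rw [h1] at hy; simp at hy
    · simp only [pt, map_add, map_pow, map_one, map_zero, map_neg] at hy ⊢
      linear_combination hy
  have hX : (cantorTheta p) ^ 2 * (pt (X : (ZMod p)[X]) ^ 2 + 1) = 1 := by simpa using hsq
  refine ⟨⟨not_isRat_of_irr (irr_of_sq (two_ne p hodd) hP hsq2), hquad P hP _ hsq2⟩, ?_⟩
  exact main_abstract (irr_of_sq (two_ne p hodd) (V := X) (by simp) hX)
    (hquad X (by simp) _ hX) hP (fun r _ ε hε => cantor_low p hodd r ε hε) (cantor_up p hodd)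


lemma tm_double (n : ℕ) : thueMorse (2 * n) = thueMorse n := by
  rcases n with _ | n
  · rfl
  · unfold thueMorse
    rw [show 2 * (n+1) = 0 + 2 * (n+1) by ring, Nat.digits_add 2 (by norm_num) 0 (n+1) (by norm_num) (by simp)]
    simp

lemma tm_double_succ (n : ℕ) : thueMorse (2 * n + 1) = thueMorse n + 1 := by
  unfold thueMorse
  rw [show 2 * n + 1 = 1 + 2 * n by ring, Nat.digits_add 2 (by norm_num) 1 n (by norm_num) (by simp)]
  simp [add_comm]

lemma tm_ps : (PowerSeries.mk thueMorse) = (1 + PowerSeries.X) * (PowerSeries.mk thueMorse) ^ 2 +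
    PowerSeries.X * (PowerSeries.mk (fun _ => (1 : ZMod 2))) ^ 2 := by
  ext n
  rw [add_mul, one_mul, map_add, map_add, PowerSeries.coeff_mk]
  rcases Nat.even_or_odd' n with ⟨m, rfl | rfl⟩
  · rw [tm_double, ps_pow_prime 2, if_pos (dvd_mul_right _ _), Nat.mul_div_cancel_left _ (by norm_num),
      PowerSeries.coeff_mk]
    rcases m with _ | m
    · simp
    · rw [show 2 * (m+1) = (2 * m + 1) + 1 by ring, PowerSeries.coeff_succ_X_mul,
        PowerSeries.coeff_succ_X_mul, ps_pow_prime 2, ps_pow_prime 2, if_neg (by omega),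
        if_neg (by omega)]
      simp
  · rw [tm_double_succ, ps_pow_prime 2, if_neg (by omega), PowerSeries.coeff_succ_X_mul,
        PowerSeries.coeff_succ_X_mul, ps_pow_prime 2, ps_pow_prime 2, if_pos (dvd_mul_right _ _),
        if_pos (dvd_mul_right _ _), Nat.mul_div_cancel_left _ (by norm_num),
      PowerSeries.coeff_mk, PowerSeries.coeff_mk]
    simp

lemma two_zero : (2 : LaurentSeries (ZMod 2)) = 0 := by
  have h : algebraMap (ZMod 2) (LaurentSeries (ZMod 2)) 2 = 0 := by
    rw [show (2 : ZMod 2) = 0 from rfl, map_zero]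
  rwa [map_ofNat] at h

lemma two_zero' : (2 : (ZMod 2)[X]) = 0 := by
  have h : C (2 : ZMod 2) = 0 := by
    rw [show (2 : ZMod 2) = 0 from rfl, map_zero]
  rwa [map_ofNat] at h

lemma tm_facts : ∃ y : LaurentSeries (ZMod 2), tmSeries * (tLS _ + 1) = tLS _ * y ∧
    (y ^ 2 + y) * (tLS _ + 1) = 1 ∧ oge 1 tmSeries ∧ y ≠ 0 ∧ y.order = 1 := by
  have h0 := t_mul_single (K := ZMod 2)
  have h1 := congrArg (HahnSeries.ofPowerSeries ℤ (ZMod 2)) tm_ps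
  have h2 := congrArg (HahnSeries.ofPowerSeries ℤ (ZMod 2))
    (PowerSeries.mk_one_mul_one_sub_eq_one (ZMod 2))
  have hz := two_zero
  have ho : oge 1 tmSeries := by
    apply oge_coeff
    intro m hm
    rw [tmSeries]
    rcases lt_or_ge m 0 with h | h
    · rw [ofPS_neg _ h]
    · have : m = ((0:ℕ) : ℤ) := by push_cast; omega
      rw [this, HahnSeries.ofPowerSeries_apply_coeff, PowerSeries.coeff_mk]
      simp [thueMorse]
  simp only [map_mul, map_add, map_sub, map_one, map_pow, HahnSeries.ofPowerSeries_X] at h1 h2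
  change tmSeries = (1 + _) * tmSeries ^ 2 + _ at h1
  change HahnSeries.ofPowerSeries ℤ (ZMod 2) (PowerSeries.mk fun _ => (1 : ZMod 2)) * _ = 1 at h2
  set s : LaurentSeries (ZMod 2) := HahnSeries.single (1:ℤ) 1 with hs
  set I := HahnSeries.ofPowerSeries ℤ (ZMod 2) (PowerSeries.mk fun _ => (1 : ZMod 2))
  have hso : oge 0 (1 + s) := by
    have a1 : oge 0 (1 : LaurentSeries (ZMod 2)) := by
      rw [oge_iff one_ne_zero, HahnSeries.order_one]
    refine a1.add ?_
    have : s ≠ 0 := right_ne_zero_of_mul_eq_one h0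
    rw [oge_iff this, hs, HahnSeries.order_single one_ne_zero]; norm_num
  have hy2 : (((1 + s) * tmSeries) ^ 2 + (1 + s) * tmSeries) * (tLS _ + 1) = 1 := by
    have e1 : ((1 + s) * tmSeries) ^ 2 + (1 + s) * tmSeries = (1 + s) * s * I ^ 2 := by
      linear_combination (1 + s) * h1 + (1+s)^2 * tmSeries^2 * hz
    have e2 : I * (1 + s) = 1 := by linear_combination h2 + I * s * hz
    rw [e1]
    linear_combination (s * I * (tLS _ + 1) + 1) * e2 + I * h0
  refine ⟨(1 + s) * tmSeries, ?_, hy2, ho, ?_⟩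
  · linear_combination -tmSeries * h0
  have hyo : oge 1 ((1 + s) * tmSeries) := (hso.mul ho).mono (by norm_num)
  set y := (1 + s) * tmSeries
  have hy0 : y ≠ 0 := by intro h; rw [h] at hy2; simp at hy2
  refine ⟨hy0, ?_⟩
  have hyo1 := hyo.le hy0
  have a := order_add_left hy0 (g := y ^ 2) ((oge_pow_order (z := y) 2).mono (by push_cast; omega))
  rw [add_comm] at a
  have b := order_add_left (f := tLS (ZMod 2)) tLS_ne (g := 1)
    (by rw [tLS_order, oge_iff one_ne_zero, HahnSeries.order_one]; norm_num)
  have c := HahnSeries.order_mul a.1 b.1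
  rw [hy2, HahnSeries.order_one, a.2, b.2, tLS_order] at c
  omega

lemma irr_of_as {V : K[X]} (hV : 1 ≤ V.natDegree) {y : LaurentSeries K}
    (hy : (y ^ 2 + y) * (pt V + 1) = 1) : Irr y := by
  intro Q P hQ he
  have hpoly : P * (P + Q) * (V + 1) = Q ^ 2 := by
    apply pt_inj
    simp only [pt, map_mul, map_pow, map_add, map_one] at he hy ⊢
    rw [← he]; linear_combination (aeval (tLS K) Q) ^ 2 * hy
  obtain ⟨g, P', Q', hg, hcop, hP', hQ'⟩ : ∃ g P' Q' : K[X], g ≠ 0 ∧ IsCoprime P' Q' ∧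
      P = g * P' ∧ Q = g * Q' := by
    refine ⟨gcd P Q, P / gcd P Q, Q / gcd P Q, ?_, ?_, ?_, ?_⟩
    · intro h; exact hQ ((gcd_eq_zero_iff _ _).1 h).2
    · exact isCoprime_div_gcd_div_gcd hQ
    · rw [EuclideanDomain.mul_div_cancel' _ (gcd_dvd_left _ _)]
      intro h; exact hQ ((gcd_eq_zero_iff _ _).1 h).2
    · rw [EuclideanDomain.mul_div_cancel' _ (gcd_dvd_right _ _)]
      intro h; exact hQ ((gcd_eq_zero_iff _ _).1 h).2
  have h2 : P' * (P' + Q') * (V + 1) = Q' ^ 2 := by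
    apply mul_left_cancel₀ (pow_ne_zero 2 hg)
    rw [hP', hQ'] at hpoly
    linear_combination hpoly
  have u1 : IsUnit P' := by
    have := (hcop.pow_right (n := 2))
    exact this.isUnit_of_dvd' dvd_rfl ⟨(P' + Q') * (V + 1), by rw [← h2]; ring⟩
  have hcop2 : IsCoprime (P' + Q') Q' := by
    have := hcop.add_mul_left_left 1
    simpa using this
  have u2 : IsUnit (P' + Q') := by
    have := (hcop2.pow_right (n := 2))
    exact this.isUnit_of_dvd' dvd_rfl ⟨P' * (V + 1), by rw [← h2]; ring⟩
  have d1 := natDegree_eq_zero_of_isUnit u1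
  have d2 := natDegree_eq_zero_of_isUnit u2
  have d3 : Q'.natDegree = 0 := by
    have : Q' = (P' + Q') - P' := by ring
    rw [this]
    have := natDegree_sub_le (P' + Q') P'
    omega
  have d4 : (V + 1).natDegree = V.natDegree := by
    rw [← C_1, natDegree_add_C]
  have hV1 : V + 1 ≠ 0 := by intro h; rw [h] at d4; simp at d4; omega
  have d5 := congrArg natDegree h2
  rw [natDegree_mul (mul_ne_zero u1.ne_zero u2.ne_zero) hV1, natDegree_mul u1.ne_zero u2.ne_zero,
    natDegree_pow, d1, d2, d3, d4] at d5
  omega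

lemma irr_tm {V : K[X]} (hV : 1 ≤ V.natDegree) {y τ : LaurentSeries K}
    (hy : (y ^ 2 + y) * (pt V + 1) = 1) (hτ : τ * (pt V + 1) = pt V * y) : Irr τ := by
  intro Q P hQ he
  have hV0 : V ≠ 0 := by rintro rfl; simp at hV
  refine irr_of_as hV hy (Q * V) (P * (V + 1)) (mul_ne_zero hQ hV0) ?_
  simp only [pt, map_mul, map_add, map_one] at he hτ ⊢
  linear_combination (aeval (tLS K) V + 1) * he - aeval (tLS K) Q * hτ

lemma quad_tm {V : K[X]} {y τ : LaurentSeries K}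
    (hy : (y ^ 2 + y) * (pt V + 1) = 1) (hτ : τ * (pt V + 1) = pt V * y) :
    ∃ a b c : K[X], a ≠ 0 ∧ pt a * τ ^ 2 + pt b * τ + pt c = 0 := by
  refine ⟨(V + 1) ^ 3, (V + 1) ^ 2 * V, -V ^ 2, ?_, ?_⟩
  · intro h0
    have h0 : V + 1 = 0 := by simpa using h0
    have h1 : pt (V + 1) = 0 := by rw [h0]; simp
    simp only [pt, map_add, map_one] at h1
    rw [h1] at hy; simp at hy
  · simp only [pt, map_add, map_mul, map_pow, map_one, map_neg] at hy hτ ⊢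
    linear_combination (aeval (tLS K) V) ^ 2 * hy + (aeval (tLS K) V + 1) *
      (τ * (aeval (tLS K) V + 1) + aeval (tLS K) V * y + aeval (tLS K) V) * hτ

lemma tm_R : ∃ y u v : LaurentSeries (ZMod 2), tmSeries * (tLS _ + 1) = tLS _ * y ∧
    y * (1 + u) = 1 ∧ u + v = 1 + tLS _ ∧ u * v = 1 ∧ (tLS _ + 1) * y = u + tLS _ ∧
    oge 1 tmSeries ∧ u ≠ 0 ∧ v ≠ 0 ∧ u.order = -1 ∧ v.order = 1 := by
  obtain ⟨y, h1, h2, h3, h4, h5⟩ := tm_facts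
  have hz := two_zero
  have hi : y * y⁻¹ = 1 := mul_inv_cancel₀ h4
  have a := order_add_left (f := y⁻¹) (inv_ne_zero h4) (g := 1)
    (by rw [order_inv' h4, h5, oge_iff one_ne_zero, HahnSeries.order_one]; norm_num)
  set u := y⁻¹ + 1 with hu
  have huo : u.order = -1 := by rw [a.2, order_inv' h4, h5]
  have hyu : y * (1 + u) = 1 := by rw [hu]; linear_combination hi + y * hz
  have huv : u * u⁻¹ = 1 := mul_inv_cancel₀ a.1
  have hyu2 : y * u = 1 + y := by linear_combination hyu - y * hz
  have hq : u ^ 2 = (1 + tLS _) * u + 1 := by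
    apply mul_left_cancel₀ (pow_ne_zero 2 h4)
    have e1 : y ^ 2 * ((1 + tLS _) * u + 1) = (1 + tLS _) * (y * (y * u)) + y ^ 2 := by ring
    rw [e1, hyu2, ← mul_pow, hyu2]
    linear_combination -h2 + y * hz
  have hv : u⁻¹ = u + (1 + tLS _) := by
    apply mul_left_cancel₀ a.1
    rw [huv]; linear_combination hq + (1 - u ^ 2) * hz
  refine ⟨y, u, u⁻¹, h1, hyu, ?_, huv, ?_, h3, a.1, inv_ne_zero a.1, huo, ?_⟩
  · rw [hv]; linear_combination u * hz
  · apply mul_left_cancel₀ a.1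
    have e1 : u * ((tLS _ + 1) * y) = (tLS _ + 1) * (y * u) := by ring
    rw [e1, hyu2]
    have e2 : (tLS (ZMod 2) + 1) * (1 + y) = u + 1 := by
      apply mul_left_cancel₀ h4
      linear_combination h2 - hyu
    rw [e2]
    linear_combination -hq - tLS _ * u * hz
  · rw [order_inv' a.1, huo]; rfl


lemma tm_pow {u v : LaurentSeries (ZMod 2)} (hs : u + v = 1 + tLS _) (huv : u * v = 1) (n : ℕ) :
    ∃ a b : (ZMod 2)[X], pt a + pt b * u = v ^ n ∧ pt a + pt b * v = u ^ n := by
  have hz := two_zero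
  induction n with
  | zero => exact ⟨1, 0, by simp, by simp⟩
  | succ n ih =>
    obtain ⟨a, b, h1, h2⟩ := ih
    refine ⟨a * (1 + X) + b, a, ?_, ?_⟩
    · rw [pow_succ, ← h1]
      simp only [pt, map_add, map_mul, map_one, aeval_X]
      linear_combination -(aeval (tLS (ZMod 2)) a) * hs - aeval (tLS (ZMod 2)) b * huv
        + u * aeval (tLS (ZMod 2)) a * hz
    · rw [pow_succ, ← h2]
      simp only [pt, map_add, map_mul, map_one, aeval_X]
      linear_combination -(aeval (tLS (ZMod 2)) a) * hs - aeval (tLS (ZMod 2)) b * huv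
        + v * aeval (tLS (ZMod 2)) a * hz

lemma tm_level {u v : LaurentSeries (ZMod 2)} (hs : u + v = 1 + tLS _) (huv : u * v = 1)
    (j s : ℕ) : ∃ a b : (ZMod 2)[X], pt a + pt b * u = v ^ (3 * 2 ^ j * s) ∧
      pt a + pt b * v = u ^ (3 * 2 ^ j * s) ∧ X ^ (2 * 2 ^ j) ∣ b := by
  have hz := two_zero
  have : CharP (LaurentSeries (ZMod 2)) 2 :=
    charP_of_injective_algebraMap (algebraMap (ZMod 2) (LaurentSeries (ZMod 2))).injective 2
  have hu2 : u ^ 2 = (1 + tLS _) * u + 1 := by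
    linear_combination u * hs - huv - hz
  have hv2 : v ^ 2 = (1 + tLS _) * v + 1 := by
    linear_combination v * hs - huv - hz
  have hc : ∀ w : LaurentSeries (ZMod 2), w ^ 2 = (1 + tLS _) * w + 1 →
      w ^ (3 * 2 ^ j) = tLS _ ^ (2 * 2 ^ j) * w ^ (2 ^ j) + (1 + tLS _) ^ (2 ^ j) := by
    intro w hw
    have : w ^ 3 = tLS _ ^ 2 * w + (1 + tLS _) := by
      linear_combination (w + 1 + tLS _) * hw + (1 + tLS (ZMod 2)) * w * hz
    rw [pow_mul, this, add_pow_char_pow, mul_pow, ← pow_mul]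
  obtain ⟨a0, b0, h1, h2⟩ := tm_pow hs huv (2 ^ j)
  induction s with
  | zero => exact ⟨1, 0, by simp, by simp, by simp⟩
  | succ s ih =>
    obtain ⟨a, b, h3, h4, ⟨b', h5⟩⟩ := ih
    set q := 2 ^ j
    refine ⟨a * (X ^ (2 * q) * a0 + (1 + X) ^ q) + b * X ^ (2 * q) * b0,
      a * (X ^ (2 * q) * b0) + b * (X ^ (2 * q) * a0 + (1 + X) ^ q) +
        b * (X ^ (2 * q) * b0) * (1 + X), ?_, ?_, ?_⟩
    · rw [mul_add (3 * q), pow_add, mul_one, hc v hv2, ← h1, ← h3]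
      simp only [pt, map_add, map_mul, map_one, map_pow, aeval_X]
      linear_combination -(aeval (tLS (ZMod 2)) b * tLS _ ^ (2 * q) * aeval (tLS _) b0) * hu2
    · rw [mul_add (3 * q), pow_add, mul_one, hc u hu2, ← h2, ← h4]
      simp only [pt, map_add, map_mul, map_one, map_pow, aeval_X]
      linear_combination -(aeval (tLS (ZMod 2)) b * tLS _ ^ (2 * q) * aeval (tLS _) b0) * hv2
    · rw [h5]
      exact ⟨a * b0 + b' * (X ^ (2 * q) * a0 + (1 + X) ^ q) +
        b' * (X ^ (2 * q) * b0) * (1 + X), by ring⟩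

lemma tm_gap (j s ρ k r x : ℕ)
    (hk : k + 1 ≤ 2 * 2 ^ j + ρ) (h1 : 3 * 2 ^ j * s + ρ + r ≤ x + k) (h2 : x + ρ < 3 * 2 ^ j * s) :
    Gap r (tLS (ZMod 2) ^ k * tmSeries) x := by
  obtain ⟨y, u, v, hτ, hyu, hs, huv, hyt, hτo, hu0, hv0, huo, hvo⟩ := tm_R
  obtain ⟨a, b, ha, hb, ⟨b', hb'⟩⟩ := tm_level hs huv j s
  have hz := two_zero
  set N := 3 * 2 ^ j * s
  have o1 := oge_pow_order (z := v) N
  have o2 := oge_pow_order (z := u) N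
  rw [hvo] at o1
  rw [huo] at o2
  obtain ⟨c, hc⟩ : ∃ c, 2 * 2 ^ j + ρ = k + 1 + c := ⟨2 * 2 ^ j + ρ - (k + 1), by omega⟩
  set t := tLS (ZMod 2) with ht
  set Q : (ZMod 2)[X] := (X + 1) ^ 2 * (X ^ c * b') with hQ
  have hQb : X ^ (k + 1) * Q = (X + 1) ^ 2 * b * X ^ ρ := by
    have : (X : (ZMod 2)[X]) ^ (k + 1) * X ^ c = X ^ (2 * 2 ^ j) * X ^ ρ := by
      rw [← pow_add, ← pow_add, hc]
    rw [hQ, hb']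
    linear_combination (X + 1) ^ 2 * b' * this
  have ht1 : t + 1 ≠ 0 := by
    have := pt_ne (Q := (X + 1 : (ZMod 2)[X])) (by rw [← C_1]; exact X_add_C_ne_zero 1)
    simpa [pt] using this
  have herr : pt Q * (t ^ k * tmSeries) - pt ((a + b * X) * X ^ ρ) = v ^ N * t ^ ρ := by
    rw [← ha]
    have h3 := congrArg pt hQb
    apply mul_left_cancel₀ ht1
    simp only [pt, map_mul, map_pow, aeval_X, map_add, map_one, ← ht] at h3 ⊢
    linear_combination aeval t Q * t ^ k * hτ + y * h3 + (t + 1) * aeval t b * t ^ ρ * hyt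
      - (t + 1) * aeval t a * t ^ ρ * hz
  have hto : oge (-(ρ : ℤ)) (t ^ ρ) := by
    have := oge_pow_order (z := t) ρ
    rw [ht, tLS_order] at this; exact this.mono (by linarith)
  have oerr : oge ((x:ℤ) + 1) (pt Q * (t ^ k * tmSeries) - pt ((a + b * X) * X ^ ρ)) := by
    rw [herr]
    refine (o1.mul hto).mono ?_
    omega
  have hQ0 : Q ≠ 0 := by
    intro h0
    rw [h0] at oerr herr
    have h3 : (a + b * X) * X ^ ρ = 0 := by
      apply pt_zero_of_oge
      have := oerr.neg
      simp only [pt, map_zero, zero_mul, zero_sub, neg_neg] at this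
      exact this.mono (by omega)
    rw [h3] at herr
    have h4 : v ^ N * t ^ ρ ≠ 0 := mul_ne_zero (pow_ne_zero _ hv0) (pow_ne_zero _ tLS_ne)
    apply h4; rw [← herr]; simp
  refine ⟨Q, _, hQ0, ?_, oerr⟩
  have h3 : ((X + 1) * b).natDegree ≤ N := by
    apply natDegree_le_of_oge
    have : pt ((X + 1) * b) = v ^ N + u ^ N := by
      rw [← ha, ← hb]
      simp only [pt, map_mul, map_add, map_one, aeval_X, ← ht]
      linear_combination -(aeval t b) * hs - aeval t a * hz
    rw [this]
    refine (o1.mono ?_).add (o2.mono ?_) <;> omega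
  have h4 : k + 1 + Q.natDegree = ((X + 1) ^ 2 * b * X ^ ρ).natDegree := by
    rw [← hQb, natDegree_mul (pow_ne_zero _ X_ne_zero) hQ0, natDegree_X_pow]
  have h5 : ((X + 1) ^ 2 * b * X ^ ρ).natDegree ≤ 1 + N + ρ := by
    rw [show (X + 1) ^ 2 * b * X ^ ρ = (X + 1) * ((X + 1) * b) * X ^ ρ by ring]
    refine natDegree_mul_le.trans ?_
    rw [natDegree_X_pow]
    have h6 := natDegree_mul_le (p := (X + 1 : (ZMod 2)[X])) (q := (X + 1) * b)
    have h7 : (X + 1 : (ZMod 2)[X]).natDegree ≤ 1 := by compute_degree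
    omega
  omega

lemma tm_low (r : ℕ) (ε : ℝ) (hε : 0 < ε) :
    ∀ᶠ k in atTop, ∃ C : ℝ, ∀ M : ℕ,
      ((2 / 3 : ℝ) - ε) * M - C ≤ gapCount r (tLS (ZMod 2) ^ k * tmSeries) M := by
  obtain ⟨k0, hk0⟩ := exists_nat_gt (2 * (r + 1) / ε)
  filter_upwards [eventually_ge_atTop (k0 + 2)] with k hk
  obtain ⟨j, hj1, hj2⟩ : ∃ j, 2 ^ (j+1) ≤ k ∧ k < 2 ^ (j+1+1) := by
    refine ⟨Nat.log 2 k - 1, ?_⟩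
    have h1 : 1 ≤ Nat.log 2 k := Nat.log_pos (by norm_num) (by omega)
    rw [Nat.sub_add_cancel h1]
    exact ⟨Nat.pow_log_le_self 2 (by omega), Nat.lt_pow_succ_log_self (by norm_num) k⟩
  have hq1 : 2 ^ (j+1) = 2 * 2 ^ j := by rw [pow_succ]; ring
  rw [pow_succ _ (j+1), hq1] at hj2
  rw [hq1] at hj1
  set q := 2 ^ j with hq
  have hq0 : 0 < q := by positivity
  have hblock : ∀ b, 4 * q - 2 * (r+1) ≤ ((Finset.Ico (6 * q * b) (6 * q * b + 6 * q)).filter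
      (Gap r (tLS (ZMod 2) ^ k * tmSeries))).card := by
    intro b
    set Y := 6 * q * b with hY
    refine le_trans ?_ (count_block _ (lo := Y) (a1 := Y + q + 1 + r)
      (b1 := Y + 5 * q - k - 1) (a2 := Y + 6 * q - k + r) (b2 := Y + 6 * q) (hi := Y + 6 * q)
      (by omega) (by omega) (by omega) (by omega) (by omega) ?_ ?_)
    · omega
    · intro x hx1 hx2
      have e : 3 * 2 ^ j * (2 * b + 1) = Y + 3 * q := by
        rw [← hq, hY]; ring
      apply tm_gap j (2 * b + 1) (k + 1 - 2 * q) k r x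
      · omega
      · rw [e]; omega
      · rw [e]; omega
    · intro x hx1 hx2
      have e : 3 * 2 ^ (j+1) * (b+1) = Y + 6 * q := by rw [hq1, hY]; ring
      apply tm_gap (j+1) (b+1) 0 k r x
      · omega
      · rw [e]; omega
      · rw [e]; omega
  have hpq0 : 0 < 6 * q := by positivity
  refine ⟨(4 * q - 2 * (r+1) : ℕ), fun M => ?_⟩
  have hc := count_lower _ _ _ hpq0 hblock M
  refine le_trans ?_ hc
  apply sub_le_sub_right
  apply mul_le_mul_of_nonneg_right _ (Nat.cast_nonneg _)
  have hL : (0:ℝ) < (6 * q : ℕ) := by exact_mod_cast hpq0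
  have hqR : (0:ℝ) < q := by exact_mod_cast hq0
  rw [le_div_iff₀ hL]
  have h1 : (4 * q : ℝ) - 2 * (r+1) ≤ (4 * q - 2 * (r+1) : ℕ) := by
    rw [sub_le_iff_le_add]; exact_mod_cast (by omega)
  refine le_trans ?_ h1
  have h2 : (k0 : ℝ) ≤ (6 * q : ℕ) := by exact_mod_cast (by omega)
  have h3 : 2 * ((r:ℝ) + 1) < k0 * ε := by rwa [div_lt_iff₀ hε] at hk0
  have h4 : k0 * ε ≤ (6 * q : ℕ) * ε := mul_le_mul_of_nonneg_right h2 hε.le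
  have h5 : (2 / 3 : ℝ) * (6 * q : ℕ) = 4 * q := by push_cast; ring
  rw [sub_mul, h5]; linarith


lemma tm_pade {M : ℕ} {a b : ZMod 2} (hab : a ≠ 0 ∨ b ≠ 0)
    (h : (X ^ 2 + X + 1 : (ZMod 2)[X]) ∣ X * (C a + C b * X ^ M)) : 3 ∣ M := by
  have hlin : ∀ c d : ZMod 2, (X ^ 2 + X + 1 : (ZMod 2)[X]) ∣ C c * X + C d → c = 0 ∧ d = 0 := by
    intro c d hd
    have hdeg : (X ^ 2 + X + 1 : (ZMod 2)[X]).natDegree = 2 := by compute_degree!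
    have h0 : C c * X + C d = 0 := by
      refine eq_zero_of_dvd_of_natDegree_lt hd ?_
      rw [hdeg]
      have : (C c * X + C d).natDegree ≤ 1 := natDegree_linear_le
      omega
    have e1 := congrArg (fun f => coeff f 1) h0
    have e0 := congrArg (fun f => coeff f 0) h0
    simp at e1 e0
    exact ⟨e1, e0⟩
  have hcube : ∀ n, (X ^ 2 + X + 1 : (ZMod 2)[X]) ∣ X ^ (3 * n) - 1 := by
    intro n
    have h1 : (X ^ 2 + X + 1 : (ZMod 2)[X]) ∣ X ^ 3 - 1 := ⟨X - 1, by ring⟩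
    rw [pow_mul]
    exact h1.trans (sub_one_dvd_pow_sub_one _ n)
  obtain ⟨n, hn | hn | hn⟩ : ∃ n, M = 3 * n ∨ M = 3 * n + 1 ∨ M = 3 * n + 2 := ⟨M / 3, by omega⟩
  · exact ⟨n, hn⟩
  · exfalso
    have h2 : (X ^ 2 + X + 1 : (ZMod 2)[X]) ∣ C (a - b) * X + C (-b) := by
      have e : C (a - b) * X + C (-b) = X * (C a + C b * X ^ M) -
          (X ^ (3 * n) - 1) * (C b * X ^ 2) - (X ^ 2 + X + 1) * C b := by
        rw [hn, map_sub, map_neg]; ring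
      rw [e]
      exact dvd_sub (dvd_sub h ((hcube n).mul_right _)) (dvd_mul_right _ _)
    obtain ⟨c1, c2⟩ := hlin _ _ h2
    have hb : b = 0 := neg_eq_zero.1 c2
    rw [hb, sub_zero] at c1
    rcases hab with h | h
    · exact h c1
    · exact h hb
  · exfalso
    have h2 : (X ^ 2 + X + 1 : (ZMod 2)[X]) ∣ C a * X + C b := by
      have e : C a * X + C b = X * (C a + C b * X ^ M) - (X ^ (3 * (n+1)) - 1) * C b := by
        rw [hn]; ring
      rw [e]
      exact dvd_sub h ((hcube (n+1)).mul_right _)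
    obtain ⟨c1, c2⟩ := hlin _ _ h2
    rcases hab with h | h
    · exact h c1
    · exact h c2

lemma tm_gap_up (j x : ℕ)
    (hg : Gap 2 (tLS (ZMod 2) ^ (2 ^ (j+1) - 1) * tmSeries) x) :
    ∃ μ : ℕ, 3 * 2 ^ j * μ < x + 2 * 2 ^ j ∧ x ≤ 3 * 2 ^ j * μ := by
  obtain ⟨y, u, v, hτ, hyu, hs, huv, hyt, hτo, hu0, hv0, huo, hvo⟩ := tm_R
  obtain ⟨Q, P, hQ0, hQd, herr⟩ := hg
  have hz := two_zero
  have hq0 : 0 < 2 ^ j := by positivity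
  have hq2 : 2 ^ (j+1) = 2 * 2 ^ j := by rw [pow_succ]; ring
  obtain ⟨k, hk⟩ : ∃ k, k + 1 = 2 ^ (j+1) := ⟨2 ^ (j+1) - 1, by omega⟩
  rw [show 2 ^ (j+1) - 1 = k by omega] at herr
  have hk1 : 1 ≤ k := by omega
  have hto : oge (-(k : ℤ)) (tLS (ZMod 2) ^ k) := by
    have := oge_pow_order (z := tLS (ZMod 2)) k
    rw [tLS_order] at this; exact this.mono (by linarith)
  have hPd : P.natDegree ≤ Q.natDegree + k - 1 := by
    refine num_deg ?_ herr
    refine ((pt_oge Q).mul (hto.mul hτo)).mono ?_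
    omega
  set t := tLS (ZMod 2) with ht
  have hu2 : (1 + t) * u = (1 + u) ^ 2 := by
    linear_combination -u * hs + huv - u * hz
  have hv2 : (1 + t) * v = (1 + v) ^ 2 := by
    linear_combination -v * hs + huv - v * hz
  set e := pt Q * t ^ (k + 1) + pt P * ((1 + t) * (1 + u)) with he
  have heo : oge ((x : ℤ) - 1) e := by
    have : e = (pt Q * (t ^ k * tmSeries) - pt P) * ((1 + t) * (1 + u)) := by
      rw [he]; linear_combination -(pt Q * t ^ k * (1 + u)) * hτ - pt Q * t ^ (k+1) * hyu
        + pt P * ((1 + t) * (1 + u)) * hz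
    rw [this]
    have b1 := order_add_left (f := t) tLS_ne (g := 1)
      (by rw [ht, tLS_order, oge_iff one_ne_zero, HahnSeries.order_one]; norm_num)
    have b2 := order_add_left (f := u) hu0 (g := 1)
      (by rw [huo, oge_iff one_ne_zero, HahnSeries.order_one]; norm_num)
    have o1 := oge_order (1 + t)
    have o2 := oge_order (1 + u)
    rw [add_comm 1 t, b1.2, ht, tLS_order, ← ht, add_comm t 1] at o1
    rw [add_comm 1 u, b2.2, huo, add_comm u 1] at o2
    exact (herr.mul (o1.mul o2)).mono (by omega)
  set m := x + k - 1 with hm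
  set T : (ZMod 2)[X] := X ^ 2 + X + 1 with hT
  have hTu : aeval u T = u * t := by
    simp only [hT, map_add, map_pow, map_one, aeval_X]
    linear_combination -hu2
  have hTv : aeval v T = v * t := by
    simp only [hT, map_add, map_pow, map_one, aeval_X]
    linear_combination -hv2
  have hTd : T.natDegree ≤ 2 := by
    rw [hT]; compute_degree
  set A := T ^ (k + 1) * homg T (m - (k + 1)) Q with hA
  set B := homg T (m - 2) P * (1 + X) ^ 3 with hB
  have hAu : aeval u A = u ^ m * (pt Q * t ^ (k + 1)) := by
    rw [hA, map_mul, map_pow, hTu, homg_aeval (by omega) hTu,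
      show u ^ m = u ^ (k + 1) * u ^ (m - (k + 1)) by rw [← pow_add]; congr 1; omega]
    ring
  have hAv : aeval v A = v ^ m * (pt Q * t ^ (k + 1)) := by
    rw [hA, map_mul, map_pow, hTv, homg_aeval (by omega) hTv,
      show v ^ m = v ^ (k + 1) * v ^ (m - (k + 1)) by rw [← pow_add]; congr 1; omega]
    ring
  have hBu : aeval u (X * B) = u ^ m * (pt P * ((1 + t) * (1 + u))) := by
    rw [hB, map_mul, map_mul, homg_aeval (by omega) hTu,
      show u ^ m = u ^ (m - 2) * u ^ 2 by rw [← pow_add]; congr 1; omega]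
    simp only [map_add, map_pow, map_one, aeval_X]
    linear_combination -(u ^ (m - 2) * pt P * (1 + u) * u) * hu2
  have hBv : aeval v B = v ^ m * (pt P * ((1 + t) * (1 + u))) := by
    rw [hB, map_mul, homg_aeval (by omega) hTv,
      show v ^ m = v ^ (m - 2) * v ^ 2 by rw [← pow_add]; congr 1; omega]
    simp only [map_add, map_pow, map_one, aeval_X]
    linear_combination -(v ^ (m - 2) * pt P * (1 + v)) * hv2
      - v ^ (m - 2) * pt P * (1 + t) * v * huv
  have hAd : A.natDegree ≤ 2 * m := by
    rw [hA]
    refine natDegree_mul_le.trans ?_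
    have e1 := homg_natDegree hTd (m - (k + 1)) Q
    have e2 := (natDegree_pow_le (p := T) (n := k + 1)).trans (Nat.mul_le_mul_left (k + 1) hTd)
    omega
  have hBd : B.natDegree ≤ 2 * m := by
    rw [hB]
    refine natDegree_mul_le.trans ?_
    have e1 := homg_natDegree hTd (m - 2) P
    have e2 : ((1 + X : (ZMod 2)[X]) ^ 3).natDegree ≤ 3 := by compute_degree
    omega
  have hGd : (A + X * B).natDegree ≤ k := by
    apply natDegree_le_of_oge_aeval huo
    rw [map_add, hAu, hBu, ← mul_add, ← he]
    have h3 := (oge_pow_order (z := u) m).mul heo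
    rw [huo] at h3
    exact h3.mono (by omega)
  obtain ⟨h, hh⟩ : X ^ (2 * x + k - 2) ∣ A + B := by
    apply X_pow_dvd_of_order (w := v) hvo
    rw [map_add, hAv, hBv, ← mul_add, ← he]
    have h3 := (oge_pow_order (z := v) m).mul heo
    rw [hvo] at h3
    exact h3.mono (by omega)
  have hhd : h.natDegree ≤ k := by
    by_cases h0 : h = 0
    · rw [h0]; simp
    have h3 : (A + B).natDegree ≤ 2 * m := natDegree_add_le_of_degree_le hAd hBd
    rw [hh, natDegree_mul (pow_ne_zero _ X_ne_zero) h0, natDegree_X_pow] at h3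
    omega
  have hXh : X ^ (2 * x + k - 1) * h = X * (A + B) := by
    rw [hh, show 2 * x + k - 1 = (2 * x + k - 2) + 1 by omega]; ring
  have hsum : (A + X * B) + X ^ (2 * x + k - 1) * h = (1 + X) * A := by
    rw [hXh]; linear_combination X * B * two_zero'
  have hexp : expand (ZMod 2) (k + 1) T = T ^ (k + 1) := by
    rw [hT, hk, add_pow_char_pow, add_pow_char_pow]
    simp only [map_add, map_pow, expand_X, map_one, one_pow]
    ring
  have hdvd : expand (ZMod 2) (k + 1) T ∣ (A + X * B) + X ^ (2 * x + k - 1) * h := by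
    rw [hsum, hexp, hA]
    exact ⟨(1 + X) * homg T (m - (k + 1)) Q, by ring⟩
  have hne : (A + X * B) + X ^ (2 * x + k - 1) * h ≠ 0 := by
    rw [hsum]
    refine mul_ne_zero ?_ ?_
    · rw [add_comm, ← C_1]; exact X_add_C_ne_zero 1
    intro h0
    have h3 := congrArg (aeval u) h0
    rw [hAu, map_zero] at h3
    exact mul_ne_zero (pow_ne_zero _ hu0)
      (mul_ne_zero (pt_ne hQ0) (pow_ne_zero _ tLS_ne)) h3
  obtain ⟨i, M, a, b, hi, hM1, hM2, hab, hΦ⟩ := pade (n := k + 1) (N := 2 * x + k - 1) (by omega)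
    (by omega) (by omega) (by omega) hdvd hne
  obtain ⟨μ, rfl⟩ := tm_pade hab hΦ
  refine ⟨μ, ?_⟩
  have e3 : (k + 1) * (3 * μ) = 2 * (3 * 2 ^ j * μ) := by rw [hk, hq2]; ring
  rw [e3] at hM1 hM2
  constructor <;> omega

lemma tm_up :
    ∃ᶠ k in atTop, ∃ C : ℝ, ∀ M : ℕ,
      (gapCount 2 (tLS (ZMod 2) ^ k * tmSeries) M : ℝ) ≤ (2 / 3 : ℝ) * M + C := by
  rw [frequently_atTop]
  intro j
  have hj : j < 2 ^ j := Nat.lt_pow_self (by norm_num)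
  have hq2 : 2 ^ (j+1) = 2 * 2 ^ j := by rw [pow_succ]; ring
  refine ⟨2 ^ (j+1) - 1, by omega, 2 * (2 * 2 ^ j : ℕ), fun M => ?_⟩
  have h := count_upper _ (3 * 2 ^ j) (2 * 2 ^ j) (by positivity)
    (Nat.mul_le_mul_right _ (by norm_num)) (tm_gap_up j) M
  have e : (((2 * 2 ^ j : ℕ) : ℝ) / ((3 * 2 ^ j : ℕ) : ℝ)) = 2 / 3 := by
    push_cast; field_simp
  rw [e] at h
  exact h

lemma tm_final (P : (ZMod 2)[X]) (hP : 1 ≤ P.natDegree) :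
    IsQuadIrr (substLS tmSeries P) ∧
        ExhibitsExactEscape (Polynomial.aeval (tLS (ZMod 2)) P) (substLS tmSeries P)
          (2 / 3) := by
  obtain ⟨y, hτ, hy, -⟩ := tm_facts
  obtain ⟨φ, hφ, ht, ha, ho⟩ := exists_phi P hP
  have hτ2 := congrArg φ hτ
  have hy2 := congrArg φ hy
  simp only [map_mul, map_add, map_pow, map_one, ht] at hτ2 hy2
  rw [hφ tmSeries] at hτ2
  have hτX : tmSeries * (pt (X : (ZMod 2)[X]) + 1) = pt X * y := by simpa using hτ
  have hyX : (y ^ 2 + y) * (pt (X : (ZMod 2)[X]) + 1) = 1 := by simpa using hy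
  refine ⟨⟨not_isRat_of_irr (irr_tm hP hy2 hτ2), quad_tm hy2 hτ2⟩, ?_⟩
  exact main_abstract (irr_tm (V := X) (by simp) hyX hτX)
    (quad_tm hyX hτX) hP (fun r _ ε hε => tm_low r ε hε) tm_up

/-- `τ(P(t))` exhibits exactly `2/3` escape of mass with respect to
`{P(t)^k}` for every irreducible `P` over `F_2`, and `Θ_p(P(t))` exhibits exactly
`2/p` escape of mass with respect to `{P(t)^k}` for every odd prime `p` and every
irreducible `P` over `F_p`. -/
theorem thueMorse_and_pCantor_exact_escape_subst :
    (∀ P : Polynomial (ZMod 2), Irreducible P →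
        IsQuadIrr (substLS tmSeries P) ∧
        ExhibitsExactEscape (Polynomial.aeval (tLS (ZMod 2)) P) (substLS tmSeries P)
          (2 / 3)) ∧
    (∀ (p : ℕ) [Fact p.Prime], Odd p → ∀ P : Polynomial (ZMod p), Irreducible P →
        IsQuadIrr (substLS (cantorTheta p) P) ∧
        ExhibitsExactEscape (Polynomial.aeval (tLS (ZMod p)) P) (substLS (cantorTheta p) P)
          (2 / p)) := by
  exact ⟨fun P hP => tm_final P hP.natDegree_pos,
    fun p _ hodd P hP => cantor_final p hodd P hP.natDegree_pos⟩

end EscapeOfMass
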